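/- The pinning transition is exactly of second order: there exist c > 0 and δ₀ ∈ (0,1) such that F^p(ε_c^p + δ) ≥ c δ / log(1/δ) for all δ ∈ (0, δ₀). -/

import Mathlib

open MeasureTheory Filter Topology Set
open scoped ENNReal NNReal BigOperators

noncomputable section

/-- The field `(φ_1, …, φ_{N-1})` extended to `ℤ` with zero boundary conditions
`φ_{-1} = φ_0 = φ_N = φ_{N+1} = 0`. -/
def fieldExt (N : ℕ) (φ : Fin (N - 1) → ℝ) (i : ℤ) : ℝ :=
  if h : 0 < i ∧ i < (N : ℤ) then φ ⟨i.toNat - 1, by omega⟩ else 0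

/-- `exp(−H_{[−1,N+1]}(φ))` with zero boundary conditions, where `E = exp(−V)` and
`H_{[a,b]}(φ) = ∑_{n=a+1}^{b-1} V(φ_{n+1} + φ_{n-1} - 2 φ_n)`. -/
def hamWeight (E : ℝ → ℝ) (N : ℕ) (φ : Fin (N - 1) → ℝ) : ℝ :=
  ∏ n ∈ Finset.Icc (0 : ℤ) (N : ℤ),
    E (fieldExt N φ (n + 1) + fieldExt N φ (n - 1) - 2 * fieldExt N φ n)

/-- the single-site reference measure `ε δ_0(dx) + dx` of the pinning model -/
def pinFactor (ε : ℝ) : Measure ℝ :=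
  ENNReal.ofReal ε • Measure.dirac 0 + volume

/-- the single-site reference measure `ε δ_0(dx) + dx 1_{(x ≥ 0)}` of the wetting model -/
def wetFactor (ε : ℝ) : Measure ℝ :=
  ENNReal.ofReal ε • Measure.dirac 0 + volume.restrict (Ici 0)

/-- the pinning partition function `Z^p_{ε,N}` -/
def Zpin (E : ℝ → ℝ) (ε : ℝ) (N : ℕ) : ℝ :=
  ∫ φ : Fin (N - 1) → ℝ, hamWeight E N φ ∂(Measure.pi fun _ => pinFactor ε)

/-- the wetting partition function `Z^w_{ε,N}` -/
def Zwet (E : ℝ → ℝ) (ε : ℝ) (N : ℕ) : ℝ :=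
  ∫ φ : Fin (N - 1) → ℝ, hamWeight E N φ ∂(Measure.pi fun _ => wetFactor ε)

namespace LaplacianPinning

section

/-- One free step of the chain `(φ_{n-1}, φ_n) ↦ (φ_n, φ_{n+1})` with weight `G (Δφ_n)`. -/
def stepOp (G : ℝ → ℝ≥0∞) (f : ℝ × ℝ → ℝ≥0∞) (z : ℝ × ℝ) : ℝ≥0∞ :=
  ∫⁻ c, G (c + z.1 - 2 * z.2) * f (z.2, c)

/-- One step of the chain constrained to land at height `0`. -/
def pinOp (G : ℝ → ℝ≥0∞) (u : ℝ → ℝ≥0∞) (z : ℝ × ℝ) : ℝ≥0∞ :=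
  G (z.1 - 2 * z.2) * u z.2

/-- `n` free steps followed by a step landing at height `0`. -/
def excOp (G : ℝ → ℝ≥0∞) (n : ℕ) (u : ℝ → ℝ≥0∞) : ℝ × ℝ → ℝ≥0∞ :=
  (stepOp G)^[n] (pinOp G u)

section Basic

variable {G G' : ℝ → ℝ≥0∞} {f f' : ℝ × ℝ → ℝ≥0∞} {u u' : ℝ → ℝ≥0∞}

lemma excOp_zero : excOp G 0 u = pinOp G u := rfl

lemma excOp_succ (n : ℕ) : excOp G (n + 1) u = stepOp G (excOp G n u) :=
  Function.iterate_succ_apply' _ _ _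

lemma measurable_stepOp (hG : Measurable G) (hf : Measurable f) : Measurable (stepOp G f) := by
  unfold stepOp
  refine Measurable.lintegral_prod_right' (f := fun p : (ℝ × ℝ) × ℝ =>
    G (p.2 + p.1.1 - 2 * p.1.2) * f (p.1.2, p.2)) ?_
  fun_prop

lemma measurable_stepOp_iterate (hG : Measurable G) (hf : Measurable f) (n : ℕ) :
    Measurable ((stepOp G)^[n] f) := by
  induction n with
  | zero => exact hf
  | succ n ih => rw [Function.iterate_succ_apply']; exact measurable_stepOp hG ih

lemma measurable_pinOp (hG : Measurable G) (hu : Measurable u) : Measurable (pinOp G u) := by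
  unfold pinOp; fun_prop

lemma measurable_excOp (hG : Measurable G) (hu : Measurable u) (n : ℕ) :
    Measurable (excOp G n u) :=
  measurable_stepOp_iterate hG (measurable_pinOp hG hu) n

lemma stepOp_mono (hG : ∀ x, G x ≤ G' x) (hf : ∀ z, f z ≤ f' z) (z : ℝ × ℝ) :
    stepOp G f z ≤ stepOp G' f' z :=
  lintegral_mono fun _ => mul_le_mul' (hG _) (hf _)

lemma pinOp_mono (hG : ∀ x, G x ≤ G' x) (hu : ∀ z, u z ≤ u' z) (z : ℝ × ℝ) :
    pinOp G u z ≤ pinOp G' u' z :=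
  mul_le_mul' (hG _) (hu _)

lemma excOp_mono (hG : ∀ x, G x ≤ G' x) (hu : ∀ z, u z ≤ u' z) (n : ℕ) (z : ℝ × ℝ) :
    excOp G n u z ≤ excOp G' n u' z := by
  induction n generalizing z with
  | zero => exact pinOp_mono hG hu z
  | succ n ih => simp only [excOp_succ]; exact stepOp_mono hG ih z

lemma stepOp_tsum (hG : Measurable G) {f : ℕ → ℝ × ℝ → ℝ≥0∞} (hf : ∀ k, Measurable (f k))
    (z : ℝ × ℝ) : stepOp G (fun w => ∑' k, f k w) z = ∑' k, stepOp G (f k) z := by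
  unfold stepOp
  rw [← lintegral_tsum]
  · simp only [ENNReal.tsum_mul_left]
  · intro k
    have := hf k
    exact Measurable.aemeasurable (by fun_prop)

lemma stepOp_const_mul (hG : Measurable G) (hf : Measurable f) (a : ℝ≥0∞) (z : ℝ × ℝ) :
    stepOp G (fun w => a * f w) z = a * stepOp G f z := by
  unfold stepOp
  rw [← lintegral_const_mul]
  · simp only [mul_left_comm]
  · fun_prop

lemma stepOp_add (hG : Measurable G) (hf : Measurable f) (z : ℝ × ℝ) :
    stepOp G (fun w => f w + f' w) z = stepOp G f z + stepOp G f' z := by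
  unfold stepOp
  rw [← lintegral_add_left]
  · simp only [mul_add]
  · fun_prop

lemma excOp_tsum (hG : Measurable G) {u : ℕ → ℝ → ℝ≥0∞} (hu : ∀ k, Measurable (u k)) (n : ℕ)
    (z : ℝ × ℝ) : excOp G n (fun x => ∑' k, u k x) z = ∑' k, excOp G n (u k) z := by
  induction n generalizing z with
  | zero => simp only [excOp_zero, pinOp, ENNReal.tsum_mul_left]
  | succ n ih =>
    simp only [excOp_succ]
    rw [← stepOp_tsum hG fun k => measurable_excOp hG (hu k) n]
    congr 1
    exact funext ih

lemma excOp_const_mul (hG : Measurable G) (hu : Measurable u) (a : ℝ≥0∞) (n : ℕ) (z : ℝ × ℝ) :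
    excOp G n (fun x => a * u x) z = a * excOp G n u z := by
  induction n generalizing z with
  | zero => simp only [excOp_zero, pinOp, mul_left_comm]
  | succ n ih =>
    simp only [excOp_succ]
    rw [← stepOp_const_mul hG (measurable_excOp hG hu n)]
    congr 1
    exact funext ih

lemma excOp_add (hG : Measurable G) (hu : Measurable u) (n : ℕ) (z : ℝ × ℝ) :
    excOp G n (fun x => u x + u' x) z = excOp G n u z + excOp G n u' z := by
  induction n generalizing z with
  | zero => simp only [excOp_zero, pinOp, mul_add]
  | succ n ih =>
    simp only [excOp_succ]
    rw [← stepOp_add hG (measurable_excOp hG hu n)]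
    congr 1
    exact funext ih

lemma lintegral_shift_eq (z : ℝ × ℝ) (G : ℝ → ℝ≥0∞) :
    ∫⁻ c, G (c + z.1 - 2 * z.2) = ∫⁻ x, G x := by
  simp only [add_sub_assoc]
  exact lintegral_add_right_eq_self G _

lemma stepOp_le_of_le (hG : Measurable G) {K a : ℝ≥0∞} (hK : ∫⁻ x, G x ≤ K)
    (hf : ∀ z, f z ≤ a) (z : ℝ × ℝ) : stepOp G f z ≤ K * a := by
  calc stepOp G f z ≤ ∫⁻ c, G (c + z.1 - 2 * z.2) * a :=
        lintegral_mono fun _ => mul_le_mul' le_rfl (hf _)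
    _ = (∫⁻ x, G x) * a := by
        rw [lintegral_mul_const _ (by fun_prop), lintegral_shift_eq]
    _ ≤ K * a := mul_le_mul' hK le_rfl

lemma stepOp_iterate_le_of_le (hG : Measurable G) {a : ℝ≥0∞} (h1 : ∫⁻ x, G x ≤ 1)
    (hf : ∀ z, f z ≤ a) (n : ℕ) (z : ℝ × ℝ) : (stepOp G)^[n] f z ≤ a := by
  induction n generalizing z with
  | zero => exact hf z
  | succ n ih =>
    rw [Function.iterate_succ_apply']
    simpa using stepOp_le_of_le hG h1 ih z

end Basic

end

section Fourier

lemma measure_le_smul_of_closedBall {X : Type*} [NormedAddCommGroup X] [NormedSpace ℝ X]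
    [FiniteDimensional ℝ X] [MeasurableSpace X] [BorelSpace X] (μ ν : Measure X) [SFinite μ]
    [IsLocallyFiniteMeasure ν] (K : ℝ≥0)
    (h : ∀ x : X, ∀ ρ : ℝ, 0 < ρ → μ (Metric.closedBall x ρ) ≤ K * ν (Metric.closedBall x ρ)) :
    μ ≤ K • ν := by
  have : ProperSpace X := FiniteDimensional.proper_real X
  refine Measure.le_iff'.2 fun s => ?_
  refine VitaliFamily.measure_le_of_frequently_le (Besicovitch.vitaliFamily μ) (K • ν)
    Measure.AbsolutelyContinuous.rfl s fun x _ => ?_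
  refine (Besicovitch.tendsto_filterAt μ x).frequently (Eventually.frequently ?_)
  filter_upwards [self_mem_nhdsWithin] with ρ hρ
  exact h x ρ hρ

lemma enorm_integral_kernel_le {X Ω : Type*} [MeasurableSpace X] [MeasurableSpace Ω]
    (μ : Measure X) [IsFiniteMeasure μ] (m : Measure Ω) [SFinite m] {w : Ω → ℂ}
    (hw : Integrable w m) (hw1 : ∀ ω, ‖w ω‖ ≤ 1) {χ : Ω → X → ℂ}
    (hχ : Measurable (Function.uncurry χ)) (hχ1 : ∀ ω x, ‖χ ω x‖ ≤ 1) :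
    ‖∫ x, ∫ ω, w ω * χ ω x ∂m ∂μ‖ₑ ≤ ∫⁻ ω, ‖∫ x, χ ω x ∂μ‖ₑ ∂m := by
  have hInt : Integrable (Function.uncurry fun x ω => w ω * χ ω x) (μ.prod m) := by
    have h1 : Integrable (fun q : X × Ω => w q.2) (μ.prod m) := hw.comp_snd μ
    refine h1.mono (h1.aestronglyMeasurable.mul ?_) (ae_of_all _ fun q => ?_)
    · exact (hχ.comp measurable_swap).aestronglyMeasurable
    · simp only [Function.uncurry, norm_mul]
      exact mul_le_of_le_one_right (norm_nonneg _) (hχ1 _ _)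
  rw [integral_integral_swap hInt]
  refine (enorm_integral_le_lintegral_enorm _).trans (lintegral_mono fun ω => ?_)
  rw [integral_const_mul, enorm_mul]
  refine mul_le_of_le_one_left' ?_
  rw [← ofReal_norm]
  exact ENNReal.ofReal_le_one.2 (hw1 ω)

/-- The Gaussian kernel written as a Fourier integral. -/
lemma gaussian_kernel_eq {ρ : ℝ} (hρ : 0 < ρ) (x : ℝ) :
    ∫ t : ℝ, Complex.exp (-(ρ ^ 2 / 4 : ℝ) * (t : ℂ) ^ 2) * Complex.exp (t * x * Complex.I) =
      ((2 * √Real.pi / ρ * Real.exp (-(x / ρ) ^ 2) : ℝ) : ℂ) := by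
  have hb : 0 < (((ρ ^ 2 / 4 : ℝ) : ℂ)).re := by
    rw [Complex.ofReal_re]; positivity
  have h := fourierIntegral_gaussian hb (x : ℂ)
  have h1 : ((Real.pi : ℂ) / ((ρ ^ 2 / 4 : ℝ) : ℂ)) ^ (1 / 2 : ℂ) =
      ((2 * √Real.pi / ρ : ℝ) : ℂ) := by
    rw [← Complex.ofReal_div]
    have : (1 / 2 : ℂ) = ((1 / 2 : ℝ) : ℂ) := by norm_num
    rw [this, ← Complex.ofReal_cpow (by positivity), ← Real.sqrt_eq_rpow]
    congr 1
    rw [show Real.pi / (ρ ^ 2 / 4) = Real.pi * (2 / ρ) ^ 2 by field_simp; norm_num,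
      Real.sqrt_mul Real.pi_pos.le, Real.sqrt_sq (by positivity)]
    ring
  rw [h1] at h
  rw [Complex.ofReal_mul, Complex.ofReal_exp]
  convert h using 2
  · ext t
    rw [mul_comm]
    congr 2
    ring
  · congr 1
    push_cast
    have : (ρ : ℂ) ≠ 0 := by exact_mod_cast hρ.ne'
    field_simp

lemma integrable_gaussian_weight {ρ : ℝ} (hρ : 0 < ρ) :
    Integrable fun t : ℝ => Complex.exp (-(ρ ^ 2 / 4 : ℝ) * (t : ℂ) ^ 2) :=
  integrable_cexp_neg_mul_sq (b := ((ρ ^ 2 / 4 : ℝ) : ℂ)) (by rw [Complex.ofReal_re]; positivity)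

lemma norm_gaussian_weight_le (ρ t : ℝ) :
    ‖Complex.exp (-(ρ ^ 2 / 4 : ℝ) * (t : ℂ) ^ 2)‖ ≤ 1 := by
  rw [show (-(ρ ^ 2 / 4 : ℝ) * (t : ℂ) ^ 2 : ℂ) = ((-(ρ ^ 2 / 4) * t ^ 2 : ℝ) : ℂ) by
    push_cast; ring, Complex.norm_exp_ofReal]
  exact Real.exp_le_one_iff.2 (by nlinarith [mul_nonneg (sq_nonneg ρ) (sq_nonneg t)])

lemma one_le_exp_mul_gaussian {ρ x : ℝ} (hρ : 0 < ρ) (hx : |x| ≤ ρ) :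
    1 ≤ Real.exp 1 * Real.exp (-(x / ρ) ^ 2) := by
  rw [← Real.exp_add]
  refine Real.one_le_exp ?_
  have : (x / ρ) ^ 2 ≤ 1 := by
    rw [sq_le_one_iff_abs_le_one, abs_div, abs_of_pos hρ]
    exact (div_le_one hρ).2 hx
  linarith

lemma measure_le_of_one_le_re_integral {X : Type*} [MeasurableSpace X] (μ : Measure X)
    [IsFiniteMeasure μ] {s : Set X} (hs : MeasurableSet s) {k : X → ℝ} (hk : Integrable k μ)
    (hk0 : ∀ x, 0 ≤ k x) (hks : ∀ x ∈ s, 1 ≤ k x) :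
    μ s ≤ ‖∫ x, (k x : ℂ) ∂μ‖ₑ := by
  rw [integral_complex_ofReal]
  have h1 : ‖((∫ x, k x ∂μ : ℝ) : ℂ)‖ₑ = ENNReal.ofReal (∫ x, k x ∂μ) := by
    rw [← ofReal_norm, Complex.norm_real, Real.norm_of_nonneg (integral_nonneg hk0)]
  rw [h1, ofReal_integral_eq_lintegral_ofReal hk (ae_of_all _ hk0)]
  calc μ s = ∫⁻ x in s, 1 ∂μ := by simp
    _ ≤ ∫⁻ x in s, ENNReal.ofReal (k x) ∂μ :=
        setLIntegral_mono' hs fun x hx => by simpa using hks x hx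
    _ ≤ _ := setLIntegral_le_lintegral _ _

/-- A finite measure on the line with integrable characteristic function has a bounded density. -/
lemma exists_measure_le_lintegral_charFun : ∃ C : ℝ≥0, ∀ (μ : Measure ℝ) [IsFiniteMeasure μ]
    (K : ℝ≥0), ∫⁻ t : ℝ, ‖∫ x, Complex.exp (t * x * Complex.I) ∂μ‖ₑ ≤ K →
      μ ≤ (C * K) • volume := by
  refine ⟨(Real.exp 1 / (4 * √Real.pi)).toNNReal, fun μ _ K hK => ?_⟩
  refine measure_le_smul_of_closedBall μ volume _ fun a ρ hρ => ?_
  set k : ℝ → ℝ := fun x => Real.exp 1 * Real.exp (-((x - a) / ρ) ^ 2) with hkdef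
  have hk : Integrable k μ := by
    refine Integrable.of_bound (C := Real.exp 1) (by fun_prop) (ae_of_all _ fun x => ?_)
    rw [Real.norm_of_nonneg (by positivity)]
    exact mul_le_of_le_one_right (by positivity) (Real.exp_le_one_iff.2 (by nlinarith [sq_nonneg ((x - a) / ρ)]))
  have h1 := measure_le_of_one_le_re_integral μ (s := Metric.closedBall a ρ)
    Metric.isClosed_closedBall.measurableSet hk (fun x => by positivity)
    (fun x hx => one_le_exp_mul_gaussian hρ (by simpa [Real.dist_eq] using hx))
  refine h1.trans ?_
  have h2 : ∀ x, (k x : ℂ) = ((Real.exp 1 * (ρ / (2 * √Real.pi)) : ℝ) : ℂ) *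
      ∫ t : ℝ, Complex.exp (-(ρ ^ 2 / 4 : ℝ) * (t : ℂ) ^ 2) *
        Complex.exp (t * ((x - a : ℝ) : ℂ) * Complex.I) := by
    intro x
    rw [gaussian_kernel_eq hρ, ← Complex.ofReal_mul, hkdef]
    congr 1
    have := Real.sqrt_pos.2 Real.pi_pos
    field_simp
  simp only [h2]
  rw [integral_const_mul, enorm_mul]
  have h3 := enorm_integral_kernel_le μ volume (integrable_gaussian_weight hρ)
    (norm_gaussian_weight_le ρ)
    (χ := fun t x => Complex.exp (t * ((x - a : ℝ) : ℂ) * Complex.I))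
    (by unfold Function.uncurry; fun_prop) (fun t x => by
      rw [← Complex.ofReal_mul, Complex.norm_exp_ofReal_mul_I])
  have h4 : ∀ t : ℝ, ‖∫ x, Complex.exp (t * ((x - a : ℝ) : ℂ) * Complex.I) ∂μ‖ₑ =
      ‖∫ x, Complex.exp (t * x * Complex.I) ∂μ‖ₑ := by
    intro t
    have : ∀ x : ℝ, Complex.exp (t * ((x - a : ℝ) : ℂ) * Complex.I) =
        Complex.exp ((-(t * a) : ℝ) * Complex.I) * Complex.exp (t * x * Complex.I) := by
      intro x; rw [← Complex.exp_add]; congr 1; push_cast; ring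
    simp only [this]
    rw [integral_const_mul, enorm_mul, ← ofReal_norm (Complex.exp _),
      Complex.norm_exp_ofReal_mul_I]
    simp
  simp only [h4] at h3
  refine (mul_le_mul' le_rfl (h3.trans hK)).trans_eq ?_
  rw [Real.volume_closedBall, ← ofReal_norm, Complex.norm_real, Real.norm_of_nonneg (by positivity),
    ENNReal.coe_mul, mul_right_comm]
  congr 1
  rw [← ENNReal.ofReal.eq_1, ← ENNReal.ofReal_mul (by positivity)]
  congr 1
  have := Real.sqrt_pos.2 Real.pi_pos
  field_simp; ring

/-- A finite measure on the plane with integrable characteristic function has a bounded density. -/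
lemma exists_measure_le_lintegral_charFun_prod : ∃ C : ℝ≥0, ∀ (μ : Measure (ℝ × ℝ))
    [IsFiniteMeasure μ] (K : ℝ≥0),
    ∫⁻ p : ℝ × ℝ, ‖∫ x, Complex.exp ((p.1 * x.1 + p.2 * x.2) * Complex.I) ∂μ‖ₑ ≤ K →
      μ ≤ (C * K) • volume := by
  refine ⟨((Real.exp 1 / (4 * √Real.pi)) ^ 2).toNNReal, fun μ _ K hK => ?_⟩
  refine measure_le_smul_of_closedBall μ volume _ fun a ρ hρ => ?_
  set k : ℝ × ℝ → ℝ := fun x => (Real.exp 1 * Real.exp (-((x.1 - a.1) / ρ) ^ 2)) *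
    (Real.exp 1 * Real.exp (-((x.2 - a.2) / ρ) ^ 2)) with hkdef
  have hk1 : ∀ x : ℝ, Real.exp 1 * Real.exp (-x ^ 2) ≤ Real.exp 1 := fun x =>
    mul_le_of_le_one_right (by positivity) (Real.exp_le_one_iff.2 (by nlinarith [sq_nonneg x]))
  have hk : Integrable k μ := by
    refine Integrable.of_bound (C := Real.exp 1 * Real.exp 1) (by fun_prop)
      (ae_of_all _ fun x => ?_)
    rw [Real.norm_of_nonneg (by positivity)]
    exact mul_le_mul (hk1 _) (hk1 _) (by positivity) (by positivity)
  have h1 := measure_le_of_one_le_re_integral μ (s := Metric.closedBall a ρ)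
    Metric.isClosed_closedBall.measurableSet hk (fun x => by positivity) (fun x hx => by
      rw [Metric.mem_closedBall, Prod.dist_eq, max_le_iff, Real.dist_eq, Real.dist_eq] at hx
      exact one_le_mul_of_one_le_of_one_le (one_le_exp_mul_gaussian hρ hx.1)
        (one_le_exp_mul_gaussian hρ hx.2))
  refine h1.trans ?_
  have h2 : ∀ x, (k x : ℂ) = (((Real.exp 1 * (ρ / (2 * √Real.pi))) ^ 2 : ℝ) : ℂ) *
      ∫ p : ℝ × ℝ, (Complex.exp (-(ρ ^ 2 / 4 : ℝ) * (p.1 : ℂ) ^ 2) *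
        Complex.exp (-(ρ ^ 2 / 4 : ℝ) * (p.2 : ℂ) ^ 2)) *
        Complex.exp ((p.1 * ((x.1 - a.1 : ℝ) : ℂ) + p.2 * ((x.2 - a.2 : ℝ) : ℂ)) * Complex.I) := by
    intro x
    let F : ℝ → ℝ → ℂ := fun y t => Complex.exp (-(ρ ^ 2 / 4 : ℝ) * (t : ℂ) ^ 2) *
      Complex.exp (t * (y : ℂ) * Complex.I)
    have h5 : (fun p : ℝ × ℝ => (Complex.exp (-(ρ ^ 2 / 4 : ℝ) * (p.1 : ℂ) ^ 2) *
        Complex.exp (-(ρ ^ 2 / 4 : ℝ) * (p.2 : ℂ) ^ 2)) *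
        Complex.exp ((p.1 * ((x.1 - a.1 : ℝ) : ℂ) + p.2 * ((x.2 - a.2 : ℝ) : ℂ)) * Complex.I)) =
        fun p : ℝ × ℝ => F (x.1 - a.1) p.1 * F (x.2 - a.2) p.2 := by
      funext p
      simp only [F, add_mul, Complex.exp_add]
      ring
    have h6 : ∀ y, ∫ t, F y t = _ := fun y => gaussian_kernel_eq hρ y
    rw [h5, Measure.volume_eq_prod, integral_prod_mul, h6, h6,
      ← Complex.ofReal_mul, ← Complex.ofReal_mul, hkdef]
    congr 1
    have := Real.sqrt_pos.2 Real.pi_pos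
    field_simp
  simp only [h2]
  rw [integral_const_mul, enorm_mul]
  have h3 := enorm_integral_kernel_le μ (volume : Measure (ℝ × ℝ))
    (w := fun p => Complex.exp (-(ρ ^ 2 / 4 : ℝ) * (p.1 : ℂ) ^ 2) *
        Complex.exp (-(ρ ^ 2 / 4 : ℝ) * (p.2 : ℂ) ^ 2))
    ((integrable_gaussian_weight hρ).mul_prod (integrable_gaussian_weight hρ))
    (fun p => by
      rw [norm_mul]
      exact mul_le_one₀ (norm_gaussian_weight_le ρ p.1) (norm_nonneg _)
        (norm_gaussian_weight_le ρ p.2))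
    (χ := fun p x => Complex.exp ((p.1 * ((x.1 - a.1 : ℝ) : ℂ) + p.2 * ((x.2 - a.2 : ℝ) : ℂ)) *
      Complex.I))
    (by unfold Function.uncurry; fun_prop) (fun t x => by
      rw [← Complex.ofReal_mul, ← Complex.ofReal_mul, ← Complex.ofReal_add,
        Complex.norm_exp_ofReal_mul_I])
  have h4 : ∀ p : ℝ × ℝ, ‖∫ x : ℝ × ℝ, Complex.exp ((p.1 * ((x.1 - a.1 : ℝ) : ℂ) +
        p.2 * ((x.2 - a.2 : ℝ) : ℂ)) * Complex.I) ∂μ‖ₑ =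
      ‖∫ x, Complex.exp ((p.1 * x.1 + p.2 * x.2) * Complex.I) ∂μ‖ₑ := by
    intro p
    have : ∀ x : ℝ × ℝ, Complex.exp ((p.1 * ((x.1 - a.1 : ℝ) : ℂ) +
        p.2 * ((x.2 - a.2 : ℝ) : ℂ)) * Complex.I) =
        Complex.exp ((-(p.1 * a.1 + p.2 * a.2) : ℝ) * Complex.I) *
          Complex.exp ((p.1 * x.1 + p.2 * x.2) * Complex.I) := by
      intro x; rw [← Complex.exp_add]; congr 1; push_cast; ring
    simp only [this]
    rw [integral_const_mul, enorm_mul, ← ofReal_norm (Complex.exp _),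
      Complex.norm_exp_ofReal_mul_I]
    simp
  simp only [h4] at h3
  refine (mul_le_mul' le_rfl (h3.trans hK)).trans_eq ?_
  have hvol : (volume : Measure (ℝ × ℝ)) (Metric.closedBall a ρ) = ENNReal.ofReal ((2 * ρ) ^ 2) := by
    rw [show a = (a.1, a.2) from rfl, ← closedBall_prod_same, Measure.volume_eq_prod,
      Measure.prod_prod, Real.volume_closedBall, Real.volume_closedBall,
      ← ENNReal.ofReal_mul (by positivity), sq]
  rw [hvol, ← ofReal_norm, Complex.norm_real, Real.norm_of_nonneg (by positivity),
    ENNReal.coe_mul, mul_right_comm]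
  congr 1
  rw [← ENNReal.ofReal.eq_1, ← ENNReal.ofReal_mul (by positivity)]
  congr 1
  have := Real.sqrt_pos.2 Real.pi_pos
  field_simp; ring

end Fourier

section CharFun

/-- The modulus of the characteristic function. -/
def cfAmp (P : Measure ℝ) (t : ℝ) : ℝ≥0∞ := ‖∫ x, Complex.exp (t * x * Complex.I) ∂P‖ₑ

lemma measurable_charFun (P : Measure ℝ) [IsFiniteMeasure P] :
    Measurable fun t : ℝ => ∫ x, Complex.exp (t * x * Complex.I) ∂P := by
  refine (StronglyMeasurable.integral_prod_right' (f := fun p : ℝ × ℝ =>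
    Complex.exp (p.1 * p.2 * Complex.I)) ?_).measurable
  exact Continuous.stronglyMeasurable (by fun_prop)

lemma measurable_cfAmp (P : Measure ℝ) [IsFiniteMeasure P] : Measurable (cfAmp P) :=
  (measurable_charFun P).enorm

lemma norm_charFun_le_one (P : Measure ℝ) [IsProbabilityMeasure P] (t : ℝ) :
    ‖∫ x, Complex.exp (t * x * Complex.I) ∂P‖ ≤ 1 := by
  refine (norm_integral_le_of_norm_le_const (C := 1) (ae_of_all _ fun x => ?_)).trans_eq (by simp)
  rw [← Complex.ofReal_mul, Complex.norm_exp_ofReal_mul_I]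

lemma cfAmp_le_one (P : Measure ℝ) [IsProbabilityMeasure P] (t : ℝ) : cfAmp P t ≤ 1 := by
  rw [cfAmp, ← ofReal_norm]
  exact ENNReal.ofReal_le_one.2 (norm_charFun_le_one P t)

lemma exists_phase (P : Measure ℝ) [IsProbabilityMeasure P] (t : ℝ) : ∃ α : ℝ,
    ENNReal.ofReal (1 - ‖∫ x, Complex.exp (t * x * Complex.I) ∂P‖) =
      ∫⁻ x, ENNReal.ofReal (1 - Real.cos (t * x + α)) ∂P := by
  set z := ∫ x, Complex.exp (t * x * Complex.I) ∂P with hz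
  refine ⟨-z.arg, ?_⟩
  have hInt : Integrable (fun x : ℝ => Real.cos (t * x + -z.arg)) P :=
    Integrable.of_bound (C := 1) (by fun_prop) (ae_of_all _ fun x => Real.abs_cos_le_one _)
  have hInt' : Integrable (fun x : ℝ => 1 - Real.cos (t * x + -z.arg)) P :=
    (integrable_const _).sub hInt
  rw [← ofReal_integral_eq_lintegral_ofReal hInt'
    (ae_of_all _ fun x => sub_nonneg.2 (Real.cos_le_one _)), integral_sub (integrable_const _) hInt]
  congr 1
  have h1 : (‖z‖ : ℂ) = Complex.exp ((-z.arg : ℝ) * Complex.I) * z := by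
    conv_rhs => rw [← Complex.norm_mul_exp_arg_mul_I z]
    rw [mul_left_comm, ← Complex.exp_add]
    push_cast
    simp
  have h2 : (‖z‖ : ℂ) = ∫ x, Complex.exp ((t * x + -z.arg : ℝ) * Complex.I) ∂P := by
    rw [h1, hz, ← integral_const_mul]
    congr 1; ext x
    rw [← Complex.exp_add]; congr 1; push_cast; ring
  have h3 : Integrable (fun x : ℝ => Complex.exp ((t * x + -z.arg : ℝ) * Complex.I)) P :=
    Integrable.of_bound (C := 1) (by fun_prop)
      (ae_of_all _ fun x => (Complex.norm_exp_ofReal_mul_I _).le)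
  have h4 : ‖z‖ = ∫ x, Real.cos (t * x + -z.arg) ∂P := by
    have := congrArg Complex.re h2
    rw [Complex.ofReal_re] at this
    rw [this]
    have h5 := integral_re h3
    simp only [RCLike.re_to_complex, Complex.exp_ofReal_mul_I_re] at h5
    exact h5.symm
  rw [h4]; simp

lemma lintegral_one_sub_cos_ge {r s : ℝ} (hr : 0 < r) (hs : 0 ≤ s) (hsr : s ≤ r) (t α : ℝ) :
    ENNReal.ofReal (2 * r * (1 - |Real.cos (t * s / 2)|)) ≤
      2 * ∫⁻ x in Icc (-r) r, ENNReal.ofReal (1 - Real.cos (t * x + α)) := by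
  set q : ℝ → ℝ≥0∞ := fun x => ENNReal.ofReal (1 - Real.cos (t * x + α)) with hq
  have hqm : Measurable q := by fun_prop
  have h1 : ∫⁻ x in Icc (-r) 0, q x ≤ ∫⁻ x in Icc (-r) r, q x :=
    lintegral_mono_set (Icc_subset_Icc_right hr.le)
  have h2 : ∫⁻ x in Icc (-r) 0, q (x + s) ≤ ∫⁻ x in Icc (-r) r, q x := by
    rw [← lintegral_indicator measurableSet_Icc, ← lintegral_indicator measurableSet_Icc,
      ← lintegral_add_right_eq_self ((Icc (-r) r).indicator q) s]
    refine lintegral_mono fun x => ?_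
    by_cases hx : x ∈ Icc (-r) 0
    · rw [indicator_of_mem hx, indicator_of_mem]
      exact ⟨by linarith [hx.1], by linarith [hx.2]⟩
    · rw [indicator_of_notMem hx]; exact zero_le
  rw [two_mul (∫⁻ x in Icc (-r) r, q x)]
  refine le_trans ?_ (add_le_add h1 h2)
  rw [← lintegral_add_left hqm]
  calc ENNReal.ofReal (2 * r * (1 - |Real.cos (t * s / 2)|))
      = ∫⁻ x in Icc (-r) 0, ENNReal.ofReal (2 * (1 - |Real.cos (t * s / 2)|)) := by
        rw [setLIntegral_const, Real.volume_Icc, ← ENNReal.ofReal_mul']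
        · congr 1; ring
        · linarith
    _ ≤ _ := by
        refine lintegral_mono fun x => ?_
        rw [hq, ← ENNReal.ofReal_add (sub_nonneg.2 (Real.cos_le_one _))
          (sub_nonneg.2 (Real.cos_le_one _))]
        refine ENNReal.ofReal_le_ofReal ?_
        have h3 : Real.cos (t * x + α) + Real.cos (t * (x + s) + α) =
            2 * Real.cos (t * x + α + t * s / 2) * Real.cos (t * s / 2) := by
          rw [Real.cos_add_cos]
          rw [show (t * x + α - (t * (x + s) + α)) / 2 = -(t * s / 2) by ring, Real.cos_neg]
          congr 3; ring
        have h4 : Real.cos (t * x + α + t * s / 2) * Real.cos (t * s / 2) ≤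
            |Real.cos (t * s / 2)| := by
          refine (le_abs_self _).trans ?_
          rw [abs_mul]
          exact mul_le_of_le_one_left (abs_nonneg _) (Real.abs_cos_le_one _)
        linarith

lemma one_sub_abs_cos_ge {w : ℝ} (hw : |w| ≤ 1) : w ^ 2 / 5 ≤ 1 - |Real.cos w| := by
  have hpi := Real.pi_gt_three
  have hpi' := Real.pi_lt_d2
  have h := Real.cos_le_one_sub_mul_cos_sq (x := w) (by linarith)
  have hc : 0 ≤ Real.cos w := Real.cos_nonneg_of_mem_Icc
    ⟨by linarith [(abs_le.1 hw).1], by linarith [(abs_le.1 hw).2]⟩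
  rw [abs_of_nonneg hc]
  have : 1 / 5 ≤ 2 / Real.pi ^ 2 := by
    rw [div_le_div_iff₀ (by norm_num) (by positivity)]; nlinarith
  nlinarith [sq_nonneg w]

lemma exists_norm_charFun_le (P : Measure ℝ) [IsProbabilityMeasure P] {e r : ℝ} (he : 0 < e)
    (hr : 0 < r) (h : ENNReal.ofReal e • volume.restrict (Icc (-r) r) ≤ P) :
    ∃ c : ℝ, 0 < c ∧ ∀ t : ℝ,
      ‖∫ x, Complex.exp (t * x * Complex.I) ∂P‖ ≤ Real.exp (-(c * min 1 (t ^ 2))) := by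
  refine ⟨e * r * min 1 (r ^ 2) / 20, by positivity, fun t => ?_⟩
  obtain ⟨α, hα⟩ := exists_phase P t
  obtain ⟨s, hs0, hsr, hs⟩ : ∃ s : ℝ, 0 ≤ s ∧ s ≤ r ∧ |t * s| = min 1 (|t| * r) := by
    rcases le_total (|t| * r) 1 with h1 | h1
    · exact ⟨r, hr.le, le_rfl, by rw [abs_mul, abs_of_pos hr, min_eq_right h1]⟩
    · have ht : 0 < |t| := by
        by_contra h2
        have : |t| = 0 := le_antisymm (not_lt.1 h2) (abs_nonneg t)
        rw [this] at h1; linarith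
      refine ⟨1 / |t|, by positivity, ?_, ?_⟩
      · rw [div_le_iff₀ ht]; linarith
      · rw [abs_mul, abs_of_pos (by positivity : 0 < 1 / |t|), min_eq_left h1]; field_simp
  have h1 := lintegral_one_sub_cos_ge hr hs0 hsr t α
  have h2 : ENNReal.ofReal e * ∫⁻ x in Icc (-r) r, ENNReal.ofReal (1 - Real.cos (t * x + α)) ≤
      ∫⁻ x, ENNReal.ofReal (1 - Real.cos (t * x + α)) ∂P := by
    rw [← smul_eq_mul, ← lintegral_smul_measure]
    exact lintegral_mono' h le_rfl
  rw [← hα] at h2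
  have h3 : ENNReal.ofReal (e * (2 * r * (1 - |Real.cos (t * s / 2)|))) ≤
      ENNReal.ofReal (2 * (1 - ‖∫ x, Complex.exp (t * x * Complex.I) ∂P‖)) := by
    rw [ENNReal.ofReal_mul he.le, ENNReal.ofReal_mul zero_le_two, ENNReal.ofReal_ofNat]
    refine (mul_le_mul' le_rfl h1).trans ?_
    rw [mul_left_comm]
    exact mul_le_mul' le_rfl h2
  have h5 := norm_charFun_le_one P t
  rw [ENNReal.ofReal_le_ofReal_iff (by linarith)] at h3
  have hm : |t * s| ≤ 1 := hs ▸ min_le_left _ _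
  have h4 := one_sub_abs_cos_ge (w := t * s / 2) (by rw [abs_div, abs_two]; linarith)
  have h6 : min 1 (r ^ 2) * min 1 (t ^ 2) ≤ (t * s) ^ 2 := by
    rw [← sq_abs (t * s), hs]
    rcases le_total 1 (|t| * r) with h7 | h7
    · rw [min_eq_left h7]
      nlinarith [min_le_left 1 (r ^ 2), min_le_left 1 (t ^ 2), sq_nonneg r, sq_nonneg t,
        le_min zero_le_one (sq_nonneg r), le_min zero_le_one (sq_nonneg t)]
    · rw [min_eq_right h7, mul_pow, sq_abs, mul_comm]
      exact mul_le_mul (min_le_right _ _) (min_le_right _ _) (by positivity) (by positivity)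
  have h7 : e * r * min 1 (r ^ 2) / 20 * min 1 (t ^ 2) ≤
      1 - ‖∫ x, Complex.exp (t * x * Complex.I) ∂P‖ := by
    have := mul_le_mul_of_nonneg_left h4 (mul_pos he hr).le
    have := mul_le_mul_of_nonneg_left h6 (mul_pos he hr).le
    nlinarith
  have := Real.add_one_le_exp (-(e * r * min 1 (r ^ 2) / 20 * min 1 (t ^ 2)))
  linarith

end CharFun

section CharFunIntegral

lemma lintegral_gaussian_kernel {ρ : ℝ} (hρ : 0 < ρ) (y : ℝ) :
    ∫⁻ x : ℝ, ENNReal.ofReal (2 * √Real.pi / ρ * Real.exp (-((x - y) / ρ) ^ 2)) =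
      ENNReal.ofReal (2 * Real.pi) := by
  rw [lintegral_sub_right_eq_self
    (fun x => ENNReal.ofReal (2 * √Real.pi / ρ * Real.exp (-(x / ρ) ^ 2))) y]
  have h0 : ∀ x : ℝ, Real.exp (-(x / ρ) ^ 2) = Real.exp (-(1 / ρ ^ 2) * x ^ 2) := fun x => by
    congr 1; field_simp
  have h1 : Integrable fun x : ℝ => 2 * √Real.pi / ρ * Real.exp (-(x / ρ) ^ 2) := by
    simp only [h0]
    exact (integrable_exp_neg_mul_sq (by positivity)).const_mul _
  rw [← ofReal_integral_eq_lintegral_ofReal h1 (ae_of_all _ fun x => by positivity),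
    integral_const_mul]
  simp only [h0]
  rw [integral_gaussian]
  congr 1
  rw [show Real.pi / (1 / ρ ^ 2) = Real.pi * ρ ^ 2 by field_simp, Real.sqrt_mul Real.pi_pos.le,
    Real.sqrt_sq hρ.le]
  field_simp
  exact Real.sq_sqrt Real.pi_pos.le

lemma lintegral_gaussian_mul_cfAmp_sq_le (P : Measure ℝ) [IsProbabilityMeasure P] {M : ℝ≥0∞}
    (hP : P ≤ M • volume) {ρ : ℝ} (hρ : 0 < ρ) :
    ∫⁻ t : ℝ, ENNReal.ofReal (Real.exp (-(ρ ^ 2 / 4) * t ^ 2)) * cfAmp P t ^ 2 ≤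
      M * ENNReal.ofReal (2 * Real.pi) := by
  set ψ : ℝ → ℂ := fun t => ∫ x, Complex.exp (t * x * Complex.I) ∂P with hψ
  set w : ℝ → ℝ := fun t => Real.exp (-(ρ ^ 2 / 4) * t ^ 2) with hw
  have hwc : ∀ t : ℝ, Complex.exp (-(ρ ^ 2 / 4 : ℝ) * (t : ℂ) ^ 2) = (w t : ℂ) := by
    intro t; rw [hw]; push_cast; rfl
  have hwint : Integrable fun t : ℝ => (w t : ℂ) := by
    simpa only [hwc] using integrable_gaussian_weight hρ
  have hψ2 : ∀ t : ℝ, ((‖ψ t‖ ^ 2 : ℝ) : ℂ) =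
      ∫ p : ℝ × ℝ, Complex.exp (t * ((p.1 - p.2 : ℝ) : ℂ) * Complex.I) ∂(P.prod P) := by
    intro t
    have h1 : (starRingEnd ℂ) (ψ t) = ∫ y, Complex.exp (-(t * y * Complex.I)) ∂P := by
      rw [hψ, ← integral_conj]
      congr 1; ext y
      rw [← Complex.exp_conj]; congr 1; simp
    rw [Complex.ofReal_pow, ← Complex.mul_conj', h1, ← integral_prod_mul]
    congr 1; ext p
    rw [← Complex.exp_add]; congr 1; push_cast; ring
  have hInt : Integrable (Function.uncurry fun (t : ℝ) (p : ℝ × ℝ) =>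
      (w t : ℂ) * Complex.exp (t * ((p.1 - p.2 : ℝ) : ℂ) * Complex.I))
      (volume.prod (P.prod P)) := by
    have h1 : Integrable (fun q : ℝ × (ℝ × ℝ) => (w q.1 : ℂ)) (volume.prod (P.prod P)) :=
      hwint.comp_fst _
    refine h1.mono (h1.aestronglyMeasurable.mul ?_) (ae_of_all _ fun q => ?_)
    · exact Continuous.aestronglyMeasurable (by fun_prop)
    · simp only [Function.uncurry, norm_mul]
      rw [← Complex.ofReal_mul, Complex.norm_exp_ofReal_mul_I, mul_one]
  have hA : ∫ t : ℝ, ((w t * ‖ψ t‖ ^ 2 : ℝ) : ℂ) = ∫ p : ℝ × ℝ,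
      ((2 * √Real.pi / ρ * Real.exp (-((p.1 - p.2) / ρ) ^ 2) : ℝ) : ℂ) ∂(P.prod P) := by
    simp only [Complex.ofReal_mul (w _), hψ2, ← integral_const_mul]
    rw [integral_integral_swap hInt]
    congr 1; ext p
    rw [← gaussian_kernel_eq hρ]
    simp only [hwc]
  have hL : ∫⁻ t : ℝ, ENNReal.ofReal (w t) * cfAmp P t ^ 2 =
      ‖∫ t : ℝ, ((w t * ‖ψ t‖ ^ 2 : ℝ) : ℂ)‖ₑ := by
    have hi : Integrable fun t : ℝ => w t * ‖ψ t‖ ^ 2 := by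
      have h1 : Integrable w := by
        have := hwint.norm
        refine this.congr (ae_of_all _ fun t => ?_)
        simp only [Complex.norm_real]
        exact Real.norm_of_nonneg (Real.exp_pos _).le
      refine h1.mono (h1.aestronglyMeasurable.mul
        ((measurable_charFun P).norm.pow_const 2).aestronglyMeasurable) (ae_of_all _ fun t => ?_)
      rw [norm_mul]
      refine mul_le_of_le_one_right (norm_nonneg _) ?_
      rw [norm_pow, norm_norm]
      exact pow_le_one₀ (norm_nonneg _) (norm_charFun_le_one P t)
    rw [integral_complex_ofReal, ← ofReal_norm, Complex.norm_real, Real.norm_of_nonneg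
      (integral_nonneg fun t => by positivity), ofReal_integral_eq_lintegral_ofReal hi
      (ae_of_all _ fun t => by positivity)]
    congr 1; ext t
    rw [ENNReal.ofReal_mul (by positivity), ENNReal.ofReal_pow (norm_nonneg _), ofReal_norm]
    rfl
  rw [hL, hA]
  refine (enorm_integral_le_lintegral_enorm _).trans ?_
  have hm : Measurable fun p : ℝ × ℝ =>
      ENNReal.ofReal (2 * √Real.pi / ρ * Real.exp (-((p.1 - p.2) / ρ) ^ 2)) := by fun_prop
  calc _ = ∫⁻ p : ℝ × ℝ, ENNReal.ofReal (2 * √Real.pi / ρ *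
            Real.exp (-((p.1 - p.2) / ρ) ^ 2)) ∂(P.prod P) := by
        congr 1; ext p
        rw [← ofReal_norm, Complex.norm_real, Real.norm_of_nonneg (by positivity)]
    _ = ∫⁻ y, ∫⁻ x, ENNReal.ofReal (2 * √Real.pi / ρ *
            Real.exp (-((x - y) / ρ) ^ 2)) ∂P ∂P := lintegral_prod_symm' _ hm
    _ ≤ ∫⁻ y, M * ENNReal.ofReal (2 * Real.pi) ∂P := by
        refine lintegral_mono fun y => ?_
        refine (lintegral_mono' hP le_rfl).trans_eq ?_
        rw [lintegral_smul_measure, lintegral_gaussian_kernel hρ, smul_eq_mul]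
    _ = _ := by simp

lemma lintegral_cfAmp_sq_le (P : Measure ℝ) [IsProbabilityMeasure P] {M : ℝ≥0∞}
    (hP : P ≤ M • volume) : ∫⁻ t : ℝ, cfAmp P t ^ 2 ≤ M * ENNReal.ofReal (2 * Real.pi) := by
  have hm := measurable_cfAmp P
  have hlim : ∀ t : ℝ, Tendsto (fun n : ℕ => ENNReal.ofReal (Real.exp
      (-((1 / ((n : ℝ) + 1)) ^ 2 / 4) * t ^ 2)) * cfAmp P t ^ 2) atTop (𝓝 (cfAmp P t ^ 2)) := by
    intro t
    have h1 : Tendsto (fun n : ℕ => Real.exp (-((1 / ((n : ℝ) + 1)) ^ 2 / 4) * t ^ 2)) atTop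
        (𝓝 1) := by
      have h2 : Tendsto (fun n : ℕ => -((1 / ((n : ℝ) + 1)) ^ 2 / 4) * t ^ 2) atTop
          (𝓝 (-((0 : ℝ) ^ 2 / 4) * t ^ 2)) :=
        (((tendsto_one_div_add_atTop_nhds_zero_nat.pow 2).div_const 4).neg).mul_const _
      simpa using h2.rexp
    have h3 := ENNReal.Tendsto.mul_const (b := cfAmp P t ^ 2) (ENNReal.tendsto_ofReal h1)
      (Or.inl (by simp))
    simpa using h3
  calc ∫⁻ t : ℝ, cfAmp P t ^ 2 = ∫⁻ t : ℝ, liminf (fun n : ℕ => ENNReal.ofReal (Real.exp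
        (-((1 / ((n : ℝ) + 1)) ^ 2 / 4) * t ^ 2)) * cfAmp P t ^ 2) atTop := by
        congr 1; ext t; exact (hlim t).liminf_eq.symm
    _ ≤ liminf (fun n : ℕ => ∫⁻ t : ℝ, ENNReal.ofReal (Real.exp
        (-((1 / ((n : ℝ) + 1)) ^ 2 / 4) * t ^ 2)) * cfAmp P t ^ 2) atTop :=
        lintegral_liminf_le fun n => by fun_prop
    _ ≤ liminf (fun _ : ℕ => M * ENNReal.ofReal (2 * Real.pi)) atTop :=
        liminf_le_liminf (Eventually.of_forall fun n =>
          lintegral_gaussian_mul_cfAmp_sq_le P hP (by positivity))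
    _ = _ := by simp

lemma exp_neg_le_inv_sqrt {x : ℝ} (hx : 0 < x) : Real.exp (-x) ≤ 1 / √x := by
  rw [Real.exp_neg, ← one_div]
  refine one_div_le_one_div_of_le (Real.sqrt_pos.2 hx) ?_
  have := Real.add_one_le_exp x
  have := Real.sq_sqrt hx.le
  nlinarith [sq_nonneg (√x - 1)]

lemma exists_lintegral_cfAmp_pow_le (P : Measure ℝ) [IsProbabilityMeasure P] {M : ℝ≥0}
    (hP : P ≤ (M : ℝ≥0∞) • volume) {e r : ℝ} (he : 0 < e) (hr : 0 < r)
    (h : ENNReal.ofReal e • volume.restrict (Icc (-r) r) ≤ P) :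
    ∃ C : ℝ, 0 < C ∧ ∀ m : ℕ, 2 ≤ m → ∫⁻ t : ℝ, cfAmp P t ^ m ≤ ENNReal.ofReal (C / √m) := by
  obtain ⟨c, hc, hg⟩ := exists_norm_charFun_le P he hr h
  set K : ℝ := M * (2 * Real.pi) with hK
  have hK0 : 0 ≤ K := by positivity
  have hKE : ENNReal.ofReal K = M * ENNReal.ofReal (2 * Real.pi) := by
    rw [hK, ENNReal.ofReal_mul (by positivity), ENNReal.ofReal_coe_nnreal]
  refine ⟨√(Real.pi / c) + Real.exp (2 * c) * K / √c, by positivity, fun m hm => ?_⟩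
  have hm0 : (0 : ℝ) < m := by exact_mod_cast (by omega : 0 < m)
  have hgE : ∀ t, cfAmp P t ≤ ENNReal.ofReal (Real.exp (-(c * min 1 (t ^ 2)))) := fun t => by
    rw [cfAmp, ← ofReal_norm]; exact ENNReal.ofReal_le_ofReal (hg t)
  have hpt : ∀ t, cfAmp P t ^ m ≤ ENNReal.ofReal (Real.exp (-(c * m) * t ^ 2)) +
      ENNReal.ofReal (Real.exp (2 * c) * Real.exp (-(c * m))) * cfAmp P t ^ 2 := by
    intro t
    rcases le_total (t ^ 2) 1 with h1 | h1
    · refine le_add_right ((pow_le_pow_left' (hgE t) m).trans_eq ?_)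
      rw [min_eq_right h1, ← ENNReal.ofReal_pow (Real.exp_pos _).le, ← Real.exp_nat_mul]
      congr 2; ring
    · refine le_add_left ?_
      obtain ⟨k, rfl⟩ := Nat.exists_eq_add_of_le' hm
      rw [pow_add]
      refine mul_le_mul' ((pow_le_pow_left' (hgE t) k).trans_eq ?_) le_rfl
      rw [min_eq_left h1, ← ENNReal.ofReal_pow (Real.exp_pos _).le, ← Real.exp_nat_mul,
        ← Real.exp_add]
      congr 2; push_cast; ring
  have hm' := measurable_cfAmp P
  calc ∫⁻ t, cfAmp P t ^ m ≤ ∫⁻ t, (ENNReal.ofReal (Real.exp (-(c * m) * t ^ 2)) +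
      ENNReal.ofReal (Real.exp (2 * c) * Real.exp (-(c * m))) * cfAmp P t ^ 2) :=
        lintegral_mono hpt
    _ = (∫⁻ t, ENNReal.ofReal (Real.exp (-(c * m) * t ^ 2))) +
      ENNReal.ofReal (Real.exp (2 * c) * Real.exp (-(c * m))) * ∫⁻ t, cfAmp P t ^ 2 := by
        rw [lintegral_add_left (by fun_prop), lintegral_const_mul _ (by fun_prop)]
    _ ≤ ENNReal.ofReal (√(Real.pi / (c * m))) +
      ENNReal.ofReal (Real.exp (2 * c) * Real.exp (-(c * m))) * ENNReal.ofReal K := by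
        refine add_le_add (le_of_eq ?_) (mul_le_mul' le_rfl ?_)
        · rw [← ofReal_integral_eq_lintegral_ofReal (integrable_exp_neg_mul_sq (by positivity))
            (ae_of_all _ fun t => (Real.exp_pos _).le), integral_gaussian]
        · rw [hKE]; exact lintegral_cfAmp_sq_le P hP
    _ = ENNReal.ofReal (√(Real.pi / (c * m)) + Real.exp (2 * c) * Real.exp (-(c * m)) * K) := by
        rw [← ENNReal.ofReal_mul (by positivity), ← ENNReal.ofReal_add (by positivity) (by positivity)]
    _ ≤ _ := by
        refine ENNReal.ofReal_le_ofReal ?_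
        have h1 : √(Real.pi / (c * m)) = √(Real.pi / c) / √m := by
          rw [← div_div, Real.sqrt_div' _ hm0.le]
        have h2 : Real.exp (-(c * m)) ≤ 1 / √c / √m := by
          refine (exp_neg_le_inv_sqrt (by positivity)).trans_eq ?_
          rw [Real.sqrt_mul hc.le, div_div]
        rw [h1, add_div]
        gcongr
        calc _ ≤ Real.exp (2 * c) * (1 / √c / √m) * K := by gcongr
          _ = _ := by ring

end CharFunIntegral

section

/-- The hypotheses on the weight `E = exp (-V)` which the argument uses. -/
structure IsStepDensity (E : ℝ → ℝ) : Prop where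
  nonneg : ∀ x, 0 ≤ E x
  cont : Continuous E
  bdd : ∃ M, ∀ x, E x ≤ M
  pos : 0 < E 0
  int : Integrable E
  mass : ∫ x, E x = 1

/-- The weight as an extended nonnegative function. -/
def wt (E : ℝ → ℝ) (x : ℝ) : ℝ≥0∞ := ENNReal.ofReal (E x)

/-- The law with density `E`. -/
def stepLaw (E : ℝ → ℝ) : Measure ℝ := volume.withDensity (wt E)

namespace IsStepDensity

variable {E : ℝ → ℝ}

lemma measurable_wt (hE : IsStepDensity E) : Measurable (wt E) := hE.cont.measurable.ennreal_ofReal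

lemma lintegral_wt (hE : IsStepDensity E) : ∫⁻ x, wt E x = 1 := by
  unfold wt
  rw [← ofReal_integral_eq_lintegral_ofReal hE.int (ae_of_all _ hE.nonneg), hE.mass,
    ENNReal.ofReal_one]

lemma exists_wt_le (hE : IsStepDensity E) : ∃ M : ℝ≥0, 1 ≤ M ∧ ∀ x, wt E x ≤ M := by
  obtain ⟨M, hM⟩ := hE.bdd
  refine ⟨(max 1 M).toNNReal, by simp, fun x => ?_⟩
  exact ENNReal.ofReal_le_ofReal ((hM x).trans (le_max_right _ _))

lemma exists_le_wt (hE : IsStepDensity E) :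
    ∃ e r : ℝ, 0 < e ∧ 0 < r ∧ ∀ x, |x| ≤ r → ENNReal.ofReal e ≤ wt E x := by
  have h1 : ∀ᶠ x in 𝓝 (0 : ℝ), E 0 / 2 < E x :=
    hE.cont.continuousAt.eventually (lt_mem_nhds (by linarith [hE.pos]))
  obtain ⟨r, hr, h⟩ := Metric.eventually_nhds_iff.1 h1
  refine ⟨E 0 / 2, r / 2, by linarith [hE.pos], by linarith, fun x hx => ?_⟩
  exact ENNReal.ofReal_le_ofReal (h (by rw [Real.dist_eq, sub_zero]; linarith)).le

lemma isProbabilityMeasure_stepLaw (hE : IsStepDensity E) : IsProbabilityMeasure (stepLaw E) :=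
  ⟨by rw [stepLaw, withDensity_apply _ MeasurableSet.univ, setLIntegral_univ, hE.lintegral_wt]⟩

lemma exists_lintegral_cfAmp_stepLaw_pow_le (hE : IsStepDensity E) :
    ∃ C : ℝ, 0 < C ∧ ∀ m : ℕ, 2 ≤ m → ∫⁻ t : ℝ, cfAmp (stepLaw E) t ^ m ≤ ENNReal.ofReal (C / √m) := by
  have := hE.isProbabilityMeasure_stepLaw
  obtain ⟨M, -, hM⟩ := hE.exists_wt_le
  obtain ⟨e, r, he, hr, her⟩ := hE.exists_le_wt
  refine exists_lintegral_cfAmp_pow_le (stepLaw E) (M := M) ?_ he hr ?_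
  · rw [stepLaw, ← withDensity_const]
    exact withDensity_mono (ae_of_all _ hM)
  · rw [stepLaw, ← withDensity_const, ← withDensity_indicator measurableSet_Icc]
    refine withDensity_mono (ae_of_all _ fun x => ?_)
    by_cases hx : x ∈ Icc (-r) r
    · rw [indicator_of_mem hx]; exact her x (abs_le.2 hx)
    · rw [indicator_of_notMem hx]; exact zero_le

end IsStepDensity

section Chain

/-- The law of `(φ_{n-1}, φ_n)` for the chain started from `z` with independent second
differences of law `P`. -/
def chainLaw (P : Measure ℝ) (z : ℝ × ℝ) : ℕ → Measure (ℝ × ℝ)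
  | 0 => Measure.dirac z
  | n + 1 => ((chainLaw P z n).prod P).map
      fun q : (ℝ × ℝ) × ℝ => (q.1.2, 2 * q.1.2 - q.1.1 + q.2)

lemma isProbabilityMeasure_chainLaw (P : Measure ℝ) [IsProbabilityMeasure P] (z : ℝ × ℝ) (n : ℕ) :
    IsProbabilityMeasure (chainLaw P z n) := by
  induction n with
  | zero => exact Measure.dirac.isProbabilityMeasure
  | succ n ih => exact Measure.isProbabilityMeasure_map (by fun_prop)

lemma lintegral_chainLaw {E : ℝ → ℝ} (hE : IsStepDensity E) {f : ℝ × ℝ → ℝ≥0∞}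
    (hf : Measurable f) (z : ℝ × ℝ) (n : ℕ) :
    ∫⁻ w, f w ∂(chainLaw (stepLaw E) z n) = (stepOp (wt E))^[n] f z := by
  have hP := hE.isProbabilityMeasure_stepLaw
  have hm := hE.measurable_wt
  induction n generalizing f with
  | zero => simp [chainLaw, lintegral_dirac' z hf]
  | succ n ih =>
    have := isProbabilityMeasure_chainLaw (stepLaw E) z n
    rw [Function.iterate_succ_apply, ← ih (measurable_stepOp hm hf), chainLaw,
      lintegral_map hf (by fun_prop), lintegral_prod _ (by fun_prop)]
    congr 1; ext w
    rw [stepLaw, lintegral_withDensity_eq_lintegral_mul _ hm (by fun_prop), stepOp,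
      ← lintegral_add_right_eq_self _ (w.1 - 2 * w.2)]
    congr 1; ext x
    simp only [Pi.mul_apply]
    congr 2
    · ring
    · congr 1; ring

lemma enorm_charFun_chainLaw (P : Measure ℝ) [IsProbabilityMeasure P] (z : ℝ × ℝ) (n : ℕ)
    (s t : ℝ) :
    ‖∫ x, Complex.exp ((s * x.1 + t * x.2) * Complex.I) ∂(chainLaw P z n)‖ₑ =
      ∏ k ∈ Finset.range n, cfAmp P (t + k * (s + t)) := by
  induction n generalizing s t with
  | zero =>
    simp only [chainLaw, integral_dirac, Finset.range_zero, Finset.prod_empty]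
    rw [← Complex.ofReal_mul, ← Complex.ofReal_mul, ← Complex.ofReal_add, ← ofReal_norm,
      Complex.norm_exp_ofReal_mul_I, ENNReal.ofReal_one]
  | succ n ih =>
    have := isProbabilityMeasure_chainLaw P z n
    have h1 : ∀ q : (ℝ × ℝ) × ℝ, Complex.exp ((s * (q.1.2 : ℂ) +
        t * ((2 * q.1.2 - q.1.1 + q.2 : ℝ) : ℂ)) * Complex.I) =
        Complex.exp ((((-t : ℝ) : ℂ) * q.1.1 + ((s + 2 * t : ℝ) : ℂ) * q.1.2) * Complex.I) *
          Complex.exp (t * q.2 * Complex.I) := by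
      intro q; rw [← Complex.exp_add]; congr 1; push_cast; ring
    rw [chainLaw, integral_map (by fun_prop)
      (Continuous.aestronglyMeasurable (by fun_prop))]
    simp only [h1]
    rw [integral_prod_mul (fun w : ℝ × ℝ =>
      Complex.exp ((((-t : ℝ) : ℂ) * w.1 + ((s + 2 * t : ℝ) : ℂ) * w.2) * Complex.I))
      (fun x : ℝ => Complex.exp (t * x * Complex.I)), enorm_mul, ih, Finset.prod_range_succ']
    congr 1
    · refine Finset.prod_congr rfl fun k _ => ?_
      congr 1; push_cast; ring
    · simp [cfAmp]

lemma lintegral_comp_mul_left {f : ℝ → ℝ≥0∞} (hf : Measurable f) {a : ℝ} (ha : a ≠ 0) :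
    ∫⁻ x, f (a * x) = ENNReal.ofReal |a⁻¹| * ∫⁻ x, f x := by
  rw [← lintegral_map hf (measurable_const_mul a), Real.map_volume_mul_left ha,
    lintegral_smul_measure, smul_eq_mul]

/-- A product of `m` functions is controlled by the integrals of their `m`-th powers. -/
lemma lintegral_prod_range_le {Ω : Type*} [MeasurableSpace Ω] {μ : Measure Ω} {m : ℕ} (hm : m ≠ 0)
    {a : ℕ → Ω → ℝ≥0∞} (ha : ∀ i, Measurable (a i)) {B : ℝ≥0∞}
    (hB : ∀ i < m, ∫⁻ ω, a i ω ^ m ∂μ ≤ B) :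
    ∫⁻ ω, ∏ i ∈ Finset.range m, a i ω ∂μ ≤ B := by
  have hm' : (m : ℝ) ≠ 0 := by exact_mod_cast hm
  have h := ENNReal.lintegral_prod_norm_pow_le (μ := μ) (Finset.range m)
    (f := fun i ω => a i ω ^ m) (p := fun _ => (m : ℝ)⁻¹)
    (fun i _ => ((ha i).pow_const m).aemeasurable)
    (by simp [hm']) (fun _ _ => by positivity)
  have h1 : ∀ x : ℝ≥0∞, (x ^ m) ^ (m : ℝ)⁻¹ = x := fun x => by
    rw [← ENNReal.rpow_natCast, ← ENNReal.rpow_mul, mul_inv_cancel₀ hm', ENNReal.rpow_one]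
  simp only [h1] at h
  refine h.trans ?_
  calc _ ≤ ∏ _i ∈ Finset.range m, B ^ (m : ℝ)⁻¹ :=
        Finset.prod_le_prod' fun i hi =>
          ENNReal.rpow_le_rpow (hB i (Finset.mem_range.1 hi)) (by positivity)
    _ = B := by
        rw [Finset.prod_const, Finset.card_range, ← ENNReal.rpow_natCast, ← ENNReal.rpow_mul,
          inv_mul_cancel₀ hm', ENNReal.rpow_one]

end Chain

end

section

section LocalBounds

lemma lintegral_lintegral_shear {F : ℝ → ℝ≥0∞} (hF : Measurable F) (i d : ℕ) (hd : d ≠ 0) :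
    ∫⁻ q : ℝ × ℝ, F (q.1 + i * q.2) * F (q.1 + (d + i : ℕ) * q.2) =
      ENNReal.ofReal (1 / d) * (∫⁻ t, F t) ^ 2 := by
  have hd' : (d : ℝ) ≠ 0 := by exact_mod_cast hd
  calc ∫⁻ q : ℝ × ℝ, F (q.1 + i * q.2) * F (q.1 + (d + i : ℕ) * q.2)
      = ∫⁻ θ : ℝ, ∫⁻ t : ℝ, F (t + i * θ) * F (t + (d + i : ℕ) * θ) := by
        rw [Measure.volume_eq_prod, lintegral_prod_symm' _ (by fun_prop)]
    _ = ∫⁻ θ : ℝ, ∫⁻ t : ℝ, F t * F (t + d * θ) := by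
        congr 1; ext θ
        rw [← lintegral_add_right_eq_self (fun t => F t * F (t + d * θ)) (i * θ)]
        congr 1; ext t
        congr 2; push_cast; ring
    _ = ∫⁻ t : ℝ, ∫⁻ θ : ℝ, F t * F (t + d * θ) :=
        lintegral_lintegral_swap (Measurable.aemeasurable (by unfold Function.uncurry; fun_prop))
    _ = ∫⁻ t : ℝ, F t * (ENNReal.ofReal (1 / d) * ∫⁻ x, F x) := by
        congr 1; ext t
        rw [lintegral_const_mul _ (by fun_prop),
          lintegral_comp_mul_left (f := fun x => F (t + x)) (by fun_prop) hd',
          lintegral_add_left_eq_self, abs_of_nonneg (by positivity), one_div]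
    _ = _ := by rw [lintegral_mul_const _ hF]; ring

lemma lintegral_prod_lattice_le {g : ℝ → ℝ≥0∞} (hg : Measurable g) (hg1 : ∀ t, g t ≤ 1) {m d : ℕ}
    (hm : m ≠ 0) (hmd : m ≤ d) :
    ∫⁻ p : ℝ × ℝ, ∏ k ∈ Finset.range (d + m), g (p.2 + k * (p.1 + p.2)) ≤
      ENNReal.ofReal (1 / d) * (∫⁻ t, g t ^ m) ^ 2 := by
  have hmeas : ∀ k : ℕ, Measurable fun q : ℝ × ℝ => g (q.1 + k * q.2) := fun k => by fun_prop
  have hpm : ∀ s : Finset ℕ, Measurable fun q : ℝ × ℝ => ∏ k ∈ s, g (q.1 + k * q.2) := fun s =>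
    Finset.measurable_prod s fun k _ => hmeas k
  calc ∫⁻ p : ℝ × ℝ, ∏ k ∈ Finset.range (d + m), g (p.2 + k * (p.1 + p.2))
      = ∫⁻ t : ℝ, ∫⁻ s : ℝ, ∏ k ∈ Finset.range (d + m), g (t + k * (s + t)) := by
        rw [Measure.volume_eq_prod, lintegral_prod_symm']
        exact (hpm _).comp (g := fun q : ℝ × ℝ => ∏ k ∈ Finset.range (d + m), g (q.1 + k * q.2))
          (f := fun p : ℝ × ℝ => (p.2, p.1 + p.2)) (by fun_prop)
    _ = ∫⁻ t : ℝ, ∫⁻ θ : ℝ, ∏ k ∈ Finset.range (d + m), g (t + k * θ) := by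
        congr 1; ext t
        exact lintegral_add_right_eq_self (fun θ => ∏ k ∈ Finset.range (d + m), g (t + k * θ)) t
    _ = ∫⁻ q : ℝ × ℝ, ∏ k ∈ Finset.range (d + m), g (q.1 + k * q.2) := by
        rw [Measure.volume_eq_prod, lintegral_prod _ (hpm _).aemeasurable]
    _ ≤ ∫⁻ q : ℝ × ℝ, ∏ i ∈ Finset.range m, (g (q.1 + i * q.2) * g (q.1 + (d + i : ℕ) * q.2)) := by
        refine lintegral_mono fun q => ?_
        rw [Finset.prod_range_add, Finset.prod_mul_distrib]
        refine mul_le_mul' ?_ le_rfl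
        exact Finset.prod_le_prod_of_subset_of_le_one' (Finset.range_mono hmd)
          fun i _ _ => hg1 _
    _ ≤ _ := by
        refine lintegral_prod_range_le hm (a := fun i (q : ℝ × ℝ) => g (q.1 + i * q.2) *
          g (q.1 + (d + i : ℕ) * q.2)) (fun i => (hmeas i).mul (hmeas (d + i))) fun i _ => ?_
        simp only [mul_pow]
        rw [lintegral_lintegral_shear (F := fun t => g t ^ m) (hg.pow_const m) i d (by omega)]

lemma lintegral_prod_dilate_le {g : ℝ → ℝ≥0∞} (hg : Measurable g) (hg1 : ∀ t, g t ≤ 1) {m d : ℕ}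
    (hm : m ≠ 0) (hd : d ≠ 0) :
    ∫⁻ t : ℝ, ∏ k ∈ Finset.range (d + m), g (-(k + 2) * t) ≤
      ENNReal.ofReal (1 / d) * ∫⁻ t, g t ^ m := by
  have hd' : (0 : ℝ) < d := by exact_mod_cast Nat.pos_of_ne_zero hd
  calc ∫⁻ t : ℝ, ∏ k ∈ Finset.range (d + m), g (-(k + 2) * t)
      ≤ ∫⁻ t : ℝ, ∏ i ∈ Finset.range m, g (-((d + i : ℕ) + 2) * t) := by
        refine lintegral_mono fun t => ?_
        rw [Finset.prod_range_add]
        exact mul_le_of_le_one_left' (Finset.prod_le_one' fun i _ => hg1 _)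
    _ ≤ _ := by
        refine lintegral_prod_range_le hm (fun i => by fun_prop) fun i _ => ?_
        have hne : (-(((d + i : ℕ) : ℝ) + 2)) ≠ 0 := by
          have : (0 : ℝ) ≤ ((d + i : ℕ) : ℝ) := by positivity
          linarith
        rw [lintegral_comp_mul_left (f := fun t => g t ^ m) (hg.pow_const m) hne]
        refine mul_le_mul' (ENNReal.ofReal_le_ofReal ?_) le_rfl
        rw [abs_inv, abs_neg, abs_of_nonneg (by positivity), ← one_div]
        refine one_div_le_one_div_of_le hd' ?_
        push_cast
        have : (0 : ℝ) ≤ i := by positivity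
        linarith

variable {E : ℝ → ℝ}

lemma excOp_le_mul_lintegral (hE : IsStepDensity E) {M : ℝ≥0} (hM : ∀ x, wt E x ≤ M) {n : ℕ}
    (hn : 1 ≤ n) (u : ℝ → ℝ≥0∞) (z : ℝ × ℝ) :
    excOp (wt E) n u z ≤ (M : ℝ≥0∞) ^ 2 * ∫⁻ x, u x := by
  obtain ⟨k, rfl⟩ := Nat.exists_eq_add_of_le' hn
  rw [excOp, Function.iterate_add_apply]
  refine stepOp_iterate_le_of_le hE.measurable_wt hE.lintegral_wt.le (fun w => ?_) k z
  rw [Function.iterate_one, stepOp]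
  have hM2 : (M : ℝ≥0∞) ^ 2 ≠ ∞ := by simp
  rw [← lintegral_const_mul' _ _ hM2]
  refine lintegral_mono fun c => ?_
  rw [pinOp, ← mul_assoc, sq]
  exact mul_le_mul' (mul_le_mul' (hM _) (hM _)) le_rfl

lemma lintegral_pinOp (hE : IsStepDensity E) {u : ℝ → ℝ≥0∞} (hu : Measurable u) :
    ∫⁻ z : ℝ × ℝ, pinOp (wt E) u z = ∫⁻ x, u x := by
  have hm := hE.measurable_wt
  rw [Measure.volume_eq_prod, lintegral_prod_symm' _ (measurable_pinOp hm hu)]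
  congr 1; ext b
  simp only [pinOp]
  rw [lintegral_mul_const _ (by fun_prop), lintegral_sub_right_eq_self (wt E), hE.lintegral_wt,
    one_mul]

lemma three_mul_half_ge {n : ℕ} (hn : 4 ≤ n) : (n : ℝ) ≤ 3 * (n / 2 : ℕ) := by
  exact_mod_cast (by omega : n ≤ 3 * (n / 2))

lemma two_mul_sub_half_ge (n : ℕ) : (n : ℝ) ≤ 2 * (n - n / 2 : ℕ) := by
  exact_mod_cast (by omega : n ≤ 2 * (n - n / 2))

/-- Local bound for the excursion kernel. -/
lemma exists_excOp_le (hE : IsStepDensity E) : ∃ C : ℝ, 0 < C ∧ ∀ n : ℕ, 1 ≤ n →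
    ∀ u : ℝ → ℝ≥0∞, Measurable u → ∀ z,
      excOp (wt E) n u z ≤ ENNReal.ofReal (C / n ^ 2) * ∫⁻ x, u x := by
  have hP := hE.isProbabilityMeasure_stepLaw
  obtain ⟨C₁, hC₁⟩ := exists_measure_le_lintegral_charFun_prod
  obtain ⟨C₂, hC₂0, hC₂⟩ := hE.exists_lintegral_cfAmp_stepLaw_pow_le
  obtain ⟨M, hM1, hM⟩ := hE.exists_wt_le
  have hM1' : (1 : ℝ) ≤ M := by exact_mod_cast hM1
  refine ⟨9 * M ^ 2 + 6 * C₁ * C₂ ^ 2, by positivity, fun n hn u hu z => ?_⟩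
  have hn0 : (0 : ℝ) < n := by exact_mod_cast hn
  rcases lt_or_ge n 4 with h4 | h4
  · refine (excOp_le_mul_lintegral hE hM hn u z).trans (mul_le_mul' ?_ le_rfl)
    rw [← ENNReal.ofReal_coe_nnreal, ← ENNReal.ofReal_pow M.coe_nonneg]
    refine ENNReal.ofReal_le_ofReal ?_
    rw [le_div_iff₀ (by positivity)]
    have h3 : (n : ℝ) ^ 2 ≤ 9 := by
      have : (n : ℝ) ≤ 3 := by exact_mod_cast (by omega : n ≤ 3)
      nlinarith
    have : 0 ≤ 6 * (C₁ : ℝ) * C₂ ^ 2 := by positivity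
    nlinarith [sq_nonneg (M : ℝ)]
  · set m := n / 2 with hm
    set d := n - m with hd
    have hnm : n = d + m := by omega
    have hmn := three_mul_half_ge h4
    have hdn := two_mul_sub_half_ge n
    rw [← hm] at hmn hdn
    rw [← hd] at hdn
    have hm0 : (0 : ℝ) < m := by linarith
    have hd0 : (0 : ℝ) < d := by linarith
    have := isProbabilityMeasure_chainLaw (stepLaw E) z n
    have hK : ∫⁻ p : ℝ × ℝ, ‖∫ x, Complex.exp ((p.1 * x.1 + p.2 * x.2) * Complex.I)
        ∂(chainLaw (stepLaw E) z n)‖ₑ ≤ ((6 * C₂ ^ 2 / n ^ 2).toNNReal : ℝ≥0) := by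
      simp only [enorm_charFun_chainLaw]
      rw [hnm]
      refine (lintegral_prod_lattice_le (measurable_cfAmp _) (cfAmp_le_one _) (by omega)
        (by omega)).trans ?_
      refine (mul_le_mul' le_rfl (pow_le_pow_left' (hC₂ m (by omega)) 2)).trans ?_
      rw [← ENNReal.ofReal_pow (by positivity), ← ENNReal.ofReal_mul (by positivity)]
      refine ENNReal.ofReal_le_ofReal ?_
      rw [← hnm, div_pow, Real.sq_sqrt hm0.le, div_mul_div_comm, one_mul,
        div_le_div_iff₀ (by positivity) (by positivity)]
      nlinarith [mul_le_mul hmn hdn hn0.le (by positivity), sq_nonneg C₂]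
    have hle := hC₁ (chainLaw (stepLaw E) z n) _ hK
    rw [excOp, ← lintegral_chainLaw hE (measurable_pinOp hE.measurable_wt hu)]
    refine (lintegral_mono' hle le_rfl).trans ?_
    rw [lintegral_smul_measure, lintegral_pinOp hE hu, ENNReal.smul_def, smul_eq_mul]
    refine mul_le_mul' ?_ le_rfl
    rw [ENNReal.coe_mul, ← ENNReal.ofReal_coe_nnreal (p := C₁), ← ENNReal.ofReal.eq_1,
      ← ENNReal.ofReal_mul C₁.coe_nonneg]
    refine ENNReal.ofReal_le_ofReal ?_
    rw [← mul_div_assoc]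
    gcongr
    nlinarith [sq_nonneg (M : ℝ)]

/-- Uniform bound for the mass of the excursion kernel. -/
lemma exists_excOp_one_le (hE : IsStepDensity E) : ∃ C : ℝ, 0 < C ∧ ∀ n : ℕ, ∀ z,
      excOp (wt E) n (fun _ => 1) z ≤ ENNReal.ofReal (C / ((n + 1) * √(n + 1))) := by
  have hP := hE.isProbabilityMeasure_stepLaw
  obtain ⟨C₁, hC₁⟩ := exists_measure_le_lintegral_charFun
  obtain ⟨C₂, hC₂0, hC₂⟩ := hE.exists_lintegral_cfAmp_stepLaw_pow_le
  obtain ⟨M, hM1, hM⟩ := hE.exists_wt_le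
  have hM1' : (1 : ℝ) ≤ M := by exact_mod_cast hM1
  refine ⟨8 * M + 16 * C₁ * C₂, by positivity, fun n z => ?_⟩
  have hn0 : (0 : ℝ) ≤ n := by positivity
  rcases lt_or_ge n 4 with h4 | h4
  · have h1 : excOp (wt E) n (fun _ => 1) z ≤ M :=
      stepOp_iterate_le_of_le hE.measurable_wt hE.lintegral_wt.le
        (fun w => by simpa [pinOp] using hM _) n z
    refine h1.trans ?_
    rw [← ENNReal.ofReal_coe_nnreal]
    refine ENNReal.ofReal_le_ofReal ?_
    rw [le_div_iff₀ (by positivity)]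
    have h3 : (n : ℝ) + 1 ≤ 4 := by exact_mod_cast (by omega : n + 1 ≤ 4)
    have h5 : √((n : ℝ) + 1) ≤ 2 := Real.sqrt_le_iff.2 ⟨by norm_num, by linarith⟩
    have h6 : ((n : ℝ) + 1) * √(n + 1) ≤ 4 * 2 := by gcongr
    have : 0 ≤ 16 * (C₁ : ℝ) * C₂ := by positivity
    nlinarith [mul_le_mul_of_nonneg_left h6 M.coe_nonneg]
  · set m := n / 2 with hm
    set d := n - m with hd
    have hnm : n = d + m := by omega
    have hmn := three_mul_half_ge h4
    have hdn := two_mul_sub_half_ge n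
    rw [← hm] at hmn hdn
    rw [← hd] at hdn
    have hn4 : (4 : ℝ) ≤ n := by exact_mod_cast h4
    have hm0 : (0 : ℝ) < m := by linarith
    have hd0 : (0 : ℝ) < d := by linarith
    have := isProbabilityMeasure_chainLaw (stepLaw E) z n
    set ν := (chainLaw (stepLaw E) z n).map fun w => w.1 - 2 * w.2 with hν
    have : IsProbabilityMeasure ν := Measure.isProbabilityMeasure_map (by fun_prop)
    have hcf : ∀ t : ℝ, ‖∫ x, Complex.exp (t * x * Complex.I) ∂ν‖ₑ =
        ∏ k ∈ Finset.range n, cfAmp (stepLaw E) (-(k + 2) * t) := by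
      intro t
      rw [hν, integral_map (by fun_prop) (Continuous.aestronglyMeasurable (by fun_prop))]
      have h1 := enorm_charFun_chainLaw (stepLaw E) z n t (-2 * t)
      convert h1 using 3
      · ext w; congr 1; push_cast; ring
      · ring
    have hK : ∫⁻ t : ℝ, ‖∫ x, Complex.exp (t * x * Complex.I) ∂ν‖ₑ ≤
        ((16 * C₂ / ((n + 1) * √(n + 1))).toNNReal : ℝ≥0) := by
      simp only [hcf]
      rw [hnm]
      refine (lintegral_prod_dilate_le (measurable_cfAmp _) (cfAmp_le_one _) (by omega)
        (by omega)).trans ?_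
      refine (mul_le_mul' le_rfl (hC₂ m (by omega))).trans ?_
      rw [← ENNReal.ofReal_mul (by positivity)]
      refine ENNReal.ofReal_le_ofReal ?_
      rw [← hnm, div_mul_div_comm, one_mul, div_le_div_iff₀ (by positivity) (by positivity)]
      have h5 : √((n : ℝ) + 1) ≤ 4 * √m := by
        rw [show (4 : ℝ) * √m = √(16 * m) by
          rw [Real.sqrt_mul (by norm_num), show (16 : ℝ) = 4 ^ 2 by norm_num,
            Real.sqrt_sq (by norm_num)]]
        exact Real.sqrt_le_sqrt (by linarith)
      have h6 : ((n : ℝ) + 1) * √(n + 1) ≤ (4 * d) * (4 * √m) := by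
        gcongr; linarith
      nlinarith [mul_le_mul_of_nonneg_left h6 hC₂0.le]
    have hle := hC₁ ν _ hK
    have h7 : excOp (wt E) n (fun _ => 1) z = ∫⁻ x, wt E x ∂ν := by
      have hm := hE.measurable_wt
      rw [excOp, ← lintegral_chainLaw hE (measurable_pinOp hm measurable_const), hν,
        lintegral_map hm (by fun_prop)]
      simp [pinOp]
    rw [h7]
    refine (lintegral_mono' hle le_rfl).trans ?_
    rw [lintegral_smul_measure, hE.lintegral_wt, ENNReal.smul_def, smul_eq_mul, mul_one,
      ENNReal.coe_mul, ← ENNReal.ofReal_coe_nnreal (p := C₁), ← ENNReal.ofReal.eq_1,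
      ← ENNReal.ofReal_mul C₁.coe_nonneg]
    refine ENNReal.ofReal_le_ofReal ?_
    rw [← mul_div_assoc]
    gcongr
    nlinarith

end LocalBounds

end

section

section Truncation

/-- The weight restricted to `[-r, r]`. -/
def cutWt (G : ℝ → ℝ≥0∞) (r : ℝ) : ℝ → ℝ≥0∞ := {x | |x| ≤ r}.indicator G

/-- The mass of the weight outside `[-r, r]`. -/
def tailMass (G : ℝ → ℝ≥0∞) (r : ℝ) : ℝ≥0∞ := ∫⁻ x in {x | r < |x|}, G x

lemma measurableSet_abs_le (r : ℝ) : MeasurableSet {x : ℝ | |x| ≤ r} :=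
  measurableSet_le measurable_norm measurable_const

lemma measurableSet_lt_abs (r : ℝ) : MeasurableSet {x : ℝ | r < |x|} :=
  measurableSet_lt measurable_const measurable_norm

lemma compl_abs_le (r : ℝ) : {x : ℝ | |x| ≤ r}ᶜ = {x | r < |x|} := by ext x; simp

variable {G : ℝ → ℝ≥0∞} {u : ℝ → ℝ≥0∞}

lemma measurable_cutWt (hG : Measurable G) (r : ℝ) : Measurable (cutWt G r) :=
  hG.indicator (measurableSet_abs_le r)

lemma cutWt_le (G : ℝ → ℝ≥0∞) (r x : ℝ) : cutWt G r x ≤ G x := indicator_le_self _ _ _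

lemma lintegral_cutWt_le (h1 : ∫⁻ x, G x ≤ 1) (r : ℝ) : ∫⁻ x, cutWt G r x ≤ 1 :=
  (lintegral_mono (cutWt_le G r)).trans h1

lemma cutWt_add (G : ℝ → ℝ≥0∞) (r x : ℝ) :
    cutWt G r x + {x | r < |x|}.indicator G x = G x := by
  rw [← compl_abs_le]
  exact congrFun (indicator_self_add_compl _ G) x

lemma lintegral_tail_indicator (G : ℝ → ℝ≥0∞) (r : ℝ) :
    ∫⁻ x, {x | r < |x|}.indicator G x = tailMass G r :=
  lintegral_indicator (measurableSet_lt_abs r) G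

lemma tendsto_tailMass {f : ℝ → ℝ≥0∞} (hf : Measurable f) (hfi : ∫⁻ x, f x ≠ ∞) :
    Tendsto (tailMass f) atTop (𝓝 0) := by
  have h := tendsto_lintegral_filter_of_dominated_convergence (μ := volume) (l := atTop)
    (F := fun R : ℝ => {x : ℝ | R < |x|}.indicator f) (f := fun _ => 0) f
    (Eventually.of_forall fun R => hf.indicator (measurableSet_lt_abs R))
    (Eventually.of_forall fun R => ae_of_all _ fun x => indicator_le_self _ _ _) hfi
    (ae_of_all _ fun x => ?_)
  · simpa only [lintegral_tail_indicator, lintegral_zero] using h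
  · refine tendsto_const_nhds.congr' ?_
    filter_upwards [eventually_ge_atTop |x|] with R hR
    rw [indicator_of_notMem]
    simpa using hR

lemma excOp_cutWt_eq_zero {r : ℝ} (hr : 0 ≤ r) {s : ℝ} (hs : |s| = 1) (k : ℕ) {a b : ℝ}
    (hb : s * b ≤ 0) (hab : (k + 1) * r < s * (a - b)) : excOp (cutWt G r) k u (a, b) = 0 := by
  have key : ∀ y : ℝ, cutWt G r y ≠ 0 → s * y ≤ r := by
    intro y hy
    have hy' : |y| ≤ r := by
      by_contra h
      exact hy (indicator_of_notMem (by simpa using h) _)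
    calc s * y ≤ |s * y| := le_abs_self _
      _ = |y| := by rw [abs_mul, hs, one_mul]
      _ ≤ r := hy'
  induction k generalizing a b with
  | zero =>
    simp only [excOp_zero, pinOp]
    refine mul_eq_zero.2 (Or.inl ?_)
    by_contra h
    have := key _ h
    push_cast at hab
    nlinarith
  | succ k ih =>
    rw [excOp_succ, stepOp]
    refine lintegral_eq_zero_of_ae_eq_zero (ae_of_all _ fun c => ?_)
    by_cases h : cutWt G r (c + a - 2 * b) = 0
    · simp [h]
    · have h1 := key _ h
      push_cast at hab
      have h2 : (k + 1) * r < s * (b - c) := by nlinarith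
      have h3 : 0 ≤ (k + 1) * r := by positivity
      have h4 := ih (a := b) (b := c) (by nlinarith) h2
      simp [h4]

lemma excOp_one_le (hG : Measurable G) (h1 : ∫⁻ x, G x ≤ 1) {M : ℝ≥0∞} (hM : ∀ x, G x ≤ M) (n : ℕ)
    (z : ℝ × ℝ) : excOp G n (fun _ => 1) z ≤ M :=
  stepOp_iterate_le_of_le hG h1 (fun w => by simpa [pinOp] using hM _) n z

lemma stepOp_le_cutWt_add (hG : Measurable G) {f : ℝ × ℝ → ℝ≥0∞} {M : ℝ≥0∞} (hf : ∀ z, f z ≤ M)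
    (hfm : Measurable f) (r : ℝ) (z : ℝ × ℝ) :
    stepOp G f z ≤ stepOp (cutWt G r) f z + tailMass G r * M := by
  have hm := measurable_cutWt hG r
  have hm' : Measurable ({x : ℝ | r < |x|}.indicator G) := hG.indicator (measurableSet_lt_abs r)
  calc stepOp G f z = stepOp (cutWt G r) f z + stepOp ({x | r < |x|}.indicator G) f z := by
        unfold stepOp
        rw [← lintegral_add_left (by fun_prop)]
        simp only [← add_mul, cutWt_add]
    _ ≤ _ := add_le_add le_rfl (stepOp_le_of_le hm' (lintegral_tail_indicator G r).le hf z)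

lemma excOp_one_le_cutWt_add (hG : Measurable G) (h1 : ∫⁻ x, G x ≤ 1) {M : ℝ≥0∞}
    (hM : ∀ x, G x ≤ M) (r : ℝ) (n : ℕ) (z : ℝ × ℝ) :
    excOp G (n + 1) (fun _ => 1) z ≤
      excOp (cutWt G r) (n + 1) (fun _ => 1) z + ((n + 1 : ℕ) + 1) * (tailMass G r * M) := by
  have hm := measurable_cutWt hG r
  induction n generalizing z with
  | zero =>
    rw [excOp_succ, excOp_succ, excOp_zero, excOp_zero]
    refine (stepOp_le_cutWt_add hG (M := M) (fun w => by simpa [pinOp] using hM _)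
      (measurable_pinOp hG measurable_const) r z).trans ?_
    have h2 : stepOp (cutWt G r) (pinOp G fun _ => 1) z ≤
        stepOp (cutWt G r) (pinOp (cutWt G r) fun _ => 1) z + tailMass G r * M := by
      have hm' : Measurable ({x : ℝ | r < |x|}.indicator G) :=
        hG.indicator (measurableSet_lt_abs r)
      calc stepOp (cutWt G r) (pinOp G fun _ => 1) z
          = stepOp (cutWt G r) (pinOp (cutWt G r) fun _ => 1) z +
            stepOp (cutWt G r) (pinOp ({x | r < |x|}.indicator G) fun _ => 1) z := by
            rw [← stepOp_add hm (measurable_pinOp hm measurable_const)]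
            congr 1; ext w
            simp only [pinOp, mul_one, cutWt_add]
        _ ≤ _ := by
            refine add_le_add le_rfl ?_
            unfold stepOp pinOp
            simp only [mul_one]
            calc _ ≤ ∫⁻ c, M * {x : ℝ | r < |x|}.indicator G (z.2 - 2 * c) :=
                  lintegral_mono fun c => mul_le_mul' ((cutWt_le G r _).trans (hM _)) le_rfl
              _ = M * ∫⁻ c, {x : ℝ | r < |x|}.indicator G (z.2 - 2 * c) :=
                  lintegral_const_mul _ (by fun_prop)
              _ ≤ M * tailMass G r := by
                  refine mul_le_mul' le_rfl ?_
                  rw [lintegral_comp_mul_left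
                    (f := fun y => {x : ℝ | r < |x|}.indicator G (z.2 - y)) (by fun_prop)
                    two_ne_zero, lintegral_sub_left_eq_self ({x : ℝ | r < |x|}.indicator G) z.2,
                    lintegral_tail_indicator]
                  refine mul_le_of_le_one_left' (ENNReal.ofReal_le_one.2 ?_)
                  norm_num
              _ = _ := mul_comm _ _
    refine (add_le_add h2 le_rfl).trans_eq ?_
    push_cast; ring
  | succ n ih =>
    rw [excOp_succ, excOp_succ (n + 1)]
    refine (stepOp_le_cutWt_add hG (fun w => excOp_one_le hG h1 hM (n + 1) w)
      (measurable_excOp hG measurable_const _) r z).trans ?_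
    have h2 : stepOp (cutWt G r) (excOp G (n + 1) fun _ => 1) z ≤
        stepOp (cutWt G r) (excOp (cutWt G r) (n + 1) fun _ => 1) z +
          1 * (((n + 1 : ℕ) + 1) * (tailMass G r * M)) := by
      refine (stepOp_mono (fun _ => le_rfl) ih z).trans ?_
      rw [stepOp_add hm (measurable_excOp hm measurable_const _)]
      exact add_le_add le_rfl
        (stepOp_le_of_le hm (lintegral_cutWt_le h1 r) (fun _ => le_rfl) z)
    refine (add_le_add h2 le_rfl).trans_eq ?_
    push_cast; ring

end Truncation

section Duality

variable {G : ℝ → ℝ≥0∞} {f g : ℝ × ℝ → ℝ≥0∞} {u ρ : ℝ → ℝ≥0∞}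

/-- The pairing of two functions of a pair, one of them read backwards. -/
def revPair (f g : ℝ × ℝ → ℝ≥0∞) : ℝ≥0∞ := ∫⁻ a, ∫⁻ b, f (b, a) * g (a, b)

lemma revPair_comm (hf : Measurable f) (hg : Measurable g) : revPair f g = revPair g f := by
  unfold revPair
  rw [lintegral_lintegral_swap (Measurable.aemeasurable (by unfold Function.uncurry; fun_prop))]
  simp only [mul_comm]

lemma revPair_stepOp_right (hG : Measurable G) (hf : Measurable f) (hg : Measurable g) :
    revPair f (stepOp G g) = ∫⁻ b, ∫⁻ a, ∫⁻ c, G (c + a - 2 * b) * (f (b, a) * g (b, c)) := by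
  unfold revPair
  have h1 : ∀ a b, f (b, a) * stepOp G g (a, b) =
      ∫⁻ c, G (c + a - 2 * b) * (f (b, a) * g (b, c)) := by
    intro a b
    rw [stepOp, ← lintegral_const_mul _ (by fun_prop)]
    congr 1; ext c; ring
  simp only [h1]
  refine lintegral_lintegral_swap (Measurable.aemeasurable ?_)
  exact Measurable.lintegral_prod_right' (f := fun p : (ℝ × ℝ) × ℝ =>
    G (p.2 + p.1.1 - 2 * p.1.2) * (f (p.1.2, p.1.1) * g (p.1.2, p.2))) (by fun_prop)

lemma revPair_stepOp (hG : Measurable G) (hf : Measurable f) (hg : Measurable g) :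
    revPair f (stepOp G g) = revPair (stepOp G f) g := by
  rw [revPair_comm (measurable_stepOp hG hf) hg, revPair_stepOp_right hG hf hg,
    revPair_stepOp_right hG hg hf]
  congr 1; ext b
  rw [lintegral_lintegral_swap (Measurable.aemeasurable (by unfold Function.uncurry; fun_prop))]
  congr 1; ext a; congr 1; ext c
  rw [add_comm a c, mul_comm (f _)]

lemma revPair_stepOp_iterate (hG : Measurable G) (hf : Measurable f) (hg : Measurable g) (n : ℕ) :
    revPair f ((stepOp G)^[n] g) = revPair ((stepOp G)^[n] f) g := by
  induction n generalizing f with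
  | zero => rfl
  | succ n ih =>
    rw [Function.iterate_succ_apply', revPair_stepOp hG hf (measurable_stepOp_iterate hG hg n),
      ih (measurable_stepOp hG hf), Function.iterate_succ_apply]

lemma lintegral_mul_excOp_succ (hG : Measurable G) (hu : Measurable u) (n : ℕ) :
    ∫⁻ c, ρ c * excOp G (n + 1) u (0, c) = revPair (pinOp G ρ) (excOp G n u) := by
  have hm := measurable_excOp hG hu n
  unfold revPair
  congr 1; ext c
  rw [excOp_succ, stepOp, ← lintegral_const_mul _ (by fun_prop)]
  congr 1; ext d
  simp only [pinOp, add_zero]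
  ring

/-- Reversibility of the excursion kernel. -/
lemma lintegral_mul_excOp_symm (hG : Measurable G) (hu : Measurable u) (hρ : Measurable ρ) (n : ℕ) :
    ∫⁻ c, ρ c * excOp G n u (0, c) = ∫⁻ b, u b * excOp G n ρ (0, b) := by
  cases n with
  | zero =>
    congr 1; ext c
    simp only [excOp_zero, pinOp]; ring
  | succ n =>
    have h1 := measurable_pinOp hG hu
    have h2 := measurable_pinOp hG hρ
    rw [lintegral_mul_excOp_succ hG hu, lintegral_mul_excOp_succ hG hρ, excOp, excOp,
      revPair_stepOp_iterate hG h2 h1, revPair_comm (measurable_stepOp_iterate hG h2 n) h1]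

lemma lintegral_excOp_succ (hG : Measurable G) (hu : Measurable u) (n : ℕ) :
    ∫⁻ x, excOp G (n + 1) u (x, 0) =
      (∫⁻ x, G x) * ∫⁻ b, u b * excOp G n (fun _ => 1) (0, b) := by
  have hm := measurable_excOp hG hu n
  rw [← lintegral_mul_excOp_symm hG hu measurable_const]
  simp only [excOp_succ, stepOp, mul_zero, sub_zero, one_mul]
  rw [lintegral_lintegral_swap (Measurable.aemeasurable (by unfold Function.uncurry; fun_prop)),
    ← lintegral_const_mul _ (by fun_prop)]
  congr 1; ext c
  rw [lintegral_mul_const _ (by fun_prop), lintegral_add_left_eq_self]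

end Duality

end

section

section Tails

/-- The excursion operator: excursions of `n + 2` steps between consecutive contacts,
discounted by `q ^ (n + 1)`. -/
def bOp (G : ℝ → ℝ≥0∞) (q : ℝ≥0∞) (u : ℝ → ℝ≥0∞) (x : ℝ) : ℝ≥0∞ :=
  ∑' n : ℕ, q ^ (n + 1) * excOp G (n + 1) u (x, 0)

variable {G : ℝ → ℝ≥0∞} {u u' : ℝ → ℝ≥0∞} {q q' : ℝ≥0∞}

lemma measurable_excOp_zero (hG : Measurable G) (hu : Measurable u) (n : ℕ) :
    Measurable fun x => excOp G n u (x, 0) :=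
  (measurable_excOp hG hu n).comp (by fun_prop : Measurable fun x : ℝ => (x, (0 : ℝ)))

lemma measurable_bOp (hG : Measurable G) (hu : Measurable u) : Measurable (bOp G q u) :=
  Measurable.tsum fun n => (measurable_excOp_zero hG hu (n + 1)).const_mul _

lemma bOp_mono (hq : q ≤ q') (hu : ∀ x, u x ≤ u' x) (x : ℝ) : bOp G q u x ≤ bOp G q' u' x :=
  ENNReal.tsum_le_tsum fun _ => mul_le_mul' (pow_le_pow_left' hq _)
    (excOp_mono (fun _ => le_rfl) hu _ _)

lemma bOp_add (hG : Measurable G) (hu : Measurable u) (x : ℝ) :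
    bOp G q (fun y => u y + u' y) x = bOp G q u x + bOp G q u' x := by
  unfold bOp
  rw [← ENNReal.tsum_add]
  simp only [excOp_add hG hu, mul_add]

lemma bOp_const_mul (hG : Measurable G) (hu : Measurable u) (a : ℝ≥0∞) (x : ℝ) :
    bOp G q (fun y => a * u y) x = a * bOp G q u x := by
  unfold bOp
  rw [← ENNReal.tsum_mul_left]
  simp only [excOp_const_mul hG hu, mul_left_comm]

lemma bOp_tsum (hG : Measurable G) {u : ℕ → ℝ → ℝ≥0∞} (hu : ∀ k, Measurable (u k)) (x : ℝ) :
    bOp G q (fun y => ∑' k, u k y) x = ∑' k, bOp G q (u k) x := by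
  unfold bOp
  rw [ENNReal.tsum_comm]
  simp only [excOp_tsum hG hu, ENNReal.tsum_mul_left]

/-- The term of index `n` in the tail series. -/
def tailTerm (G : ℝ → ℝ≥0∞) (C : ℝ) (M : ℝ≥0∞) (R : ℝ) (n : ℕ) : ℝ≥0∞ :=
  min (ENNReal.ofReal (C / ((n + 1) * √(n + 1))))
    (((n + 1 : ℕ) + 1) * (tailMass G (R / (n + 2)) * M))

lemma tsum_three_halves_ne_top (C : ℝ) :
    ∑' n : ℕ, ENNReal.ofReal (C / ((n + 1) * √(n + 1))) ≠ ∞ := by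
  have h1 : Summable fun n : ℕ => 1 / (n : ℝ) ^ (3 / 2 : ℝ) :=
    Real.summable_one_div_nat_rpow.2 (by norm_num)
  have h2 : Summable fun n : ℕ => C / (((n : ℝ) + 1) * √(n + 1)) := by
    have h3 := ((summable_nat_add_iff 1).2 h1).mul_left C
    refine h3.congr fun n => ?_
    have hn : (0 : ℝ) < (n : ℝ) + 1 := by positivity
    push_cast
    rw [show (3 / 2 : ℝ) = 1 + 1 / 2 by norm_num, Real.rpow_add hn, Real.rpow_one,
      ← Real.sqrt_eq_rpow, mul_one_div]
  exact h2.tsum_ofReal_ne_top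

lemma tendsto_tsum_tailTerm (hG : Measurable G) (hGi : ∫⁻ x, G x ≠ ∞) (C : ℝ) {M : ℝ≥0∞}
    (hM : M ≠ ∞) : Tendsto (fun R => ∑' n, tailTerm G C M R n) atTop (𝓝 0) := by
  simp only [← lintegral_count]
  have h := tendsto_lintegral_filter_of_dominated_convergence (μ := Measure.count) (l := atTop)
    (F := fun R : ℝ => tailTerm G C M R) (f := fun _ => 0)
    (fun n : ℕ => ENNReal.ofReal (C / ((n + 1) * √(n + 1))))
    (Eventually.of_forall fun R => measurable_of_countable _)
    (Eventually.of_forall fun R => ae_of_all _ fun n => min_le_left _ _)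
    (by rw [lintegral_count]; exact tsum_three_halves_ne_top C)
    (ae_of_all _ fun n => ?_)
  · simpa only [lintegral_zero] using h
  · have h1 : Tendsto (fun R : ℝ => tailMass G (R / (n + 2))) atTop (𝓝 0) :=
      (tendsto_tailMass hG hGi).comp (tendsto_id.atTop_div_const (by positivity))
    have h2 : Tendsto (fun R : ℝ => ((n + 1 : ℕ) + 1 : ℝ≥0∞) * (tailMass G (R / (n + 2)) * M)) atTop
        (𝓝 (((n + 1 : ℕ) + 1 : ℝ≥0∞) * (0 * M))) :=
      ENNReal.Tendsto.const_mul (ENNReal.Tendsto.mul_const h1 (Or.inr hM)) (Or.inr (by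
        simp))
    rw [zero_mul, mul_zero] at h2
    exact tendsto_of_tendsto_of_tendsto_of_le_of_le tendsto_const_nhds h2 (fun _ => zero_le)
      fun R => min_le_right _ _

lemma excOp_cutWt_apply_zero_eq_zero {R x : ℝ} (hR : 0 ≤ R) (hx : R < |x|) (n : ℕ) :
    excOp (cutWt G (R / (n + 2))) (n + 1) u (x, 0) = 0 := by
  have hx0 : x ≠ 0 := by rintro rfl; simp at hx; linarith
  have hs : |(SignType.sign x : ℝ)| = 1 := by
    rcases lt_or_gt_of_ne hx0 with h | h <;> simp [h]
  refine excOp_cutWt_eq_zero (by positivity) (s := SignType.sign x) hs _ (by simp) ?_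
  rw [sub_zero, sign_mul_self]
  push_cast
  rw [show ((n : ℝ) + 1 + 1) * (R / (n + 2)) = R by field_simp; ring]
  exact hx

variable {C : ℝ} {M : ℝ≥0∞}

lemma excOp_one_tail_le (hG : Measurable G) (h1 : ∫⁻ x, G x ≤ 1) (hM : ∀ x, G x ≤ M) (hC0 : 0 ≤ C)
    (hC : ∀ n : ℕ, ∀ z, excOp G n (fun _ => 1) z ≤ ENNReal.ofReal (C / ((n + 1) * √(n + 1))))
    {R x : ℝ} (hR : 0 ≤ R) (hx : R < |x|) (n : ℕ) :
    excOp G (n + 1) (fun _ => 1) (x, 0) ≤ tailTerm G C M R n := by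
  refine le_min ((hC (n + 1) _).trans (ENNReal.ofReal_le_ofReal ?_)) ?_
  · push_cast
    gcongr <;> linarith
  · refine (excOp_one_le_cutWt_add hG h1 hM (R / (n + 2)) n (x, 0)).trans_eq ?_
    rw [excOp_cutWt_apply_zero_eq_zero hR hx, zero_add]

lemma lintegral_excOp_tail_le (hG : Measurable G) (h1 : ∫⁻ x, G x = 1) (hM : ∀ x, G x ≤ M)
    (hMt : M ≠ ∞)
    (hC : ∀ n : ℕ, ∀ z, excOp G n (fun _ => 1) z ≤ ENNReal.ofReal (C / ((n + 1) * √(n + 1))))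
    (hu : Measurable u) (hui : ∫⁻ x, u x ≠ ∞) {R : ℝ} (hR : 0 ≤ R) (n : ℕ) :
    ∫⁻ x in {x | R < |x|}, excOp G (n + 2) u (x, 0) ≤ tailTerm G C M R (n + 1) * ∫⁻ x, u x := by
  set r := R / ((n + 1 : ℕ) + 2) with hr
  have hcm := measurable_cutWt hG r
  have hall : ∫⁻ x, excOp G (n + 2) u (x, 0) = ∫⁻ b, u b * excOp G (n + 1) (fun _ => 1) (0, b) := by
    rw [lintegral_excOp_succ hG hu (n + 1), h1, one_mul]
  have hmm : Measurable fun b => u b * excOp (cutWt G r) (n + 1) (fun _ => 1) (0, b) :=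
    hu.mul ((measurable_excOp hcm measurable_const _).comp
      (by fun_prop : Measurable fun x : ℝ => ((0 : ℝ), x)))
  have e1 : ∫⁻ x in {x | R < |x|}, excOp G (n + 2) u (x, 0) ≤
      ENNReal.ofReal (C / (((n + 1 : ℕ) + 1) * √((n + 1 : ℕ) + 1))) * ∫⁻ x, u x := by
    refine (setLIntegral_le_lintegral _ _).trans (hall.trans_le ?_)
    rw [mul_comm, ← lintegral_mul_const _ hu]
    exact lintegral_mono fun b => mul_le_mul' le_rfl (hC _ _)
  have hcut : ∫⁻ x, excOp (cutWt G r) (n + 2) u (x, 0) =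
      (∫⁻ x, cutWt G r x) * ∫⁻ b, u b * excOp (cutWt G r) (n + 1) (fun _ => 1) (0, b) :=
    lintegral_excOp_succ hcm hu (n + 1)
  set J := ∫⁻ b, u b * excOp (cutWt G r) (n + 1) (fun _ => 1) (0, b) with hJ
  have hJM : J ≤ M * ∫⁻ x, u x := by
    rw [mul_comm, ← lintegral_mul_const _ hu]
    exact lintegral_mono fun b => mul_le_mul' le_rfl
      (excOp_one_le hcm (lintegral_cutWt_le h1.le r) (fun x => (cutWt_le G r x).trans (hM x)) _ _)
  have hJt : (∫⁻ x, cutWt G r x) * J ≠ ∞ :=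
    ENNReal.mul_ne_top (ne_top_of_le_ne_top ENNReal.one_ne_top (lintegral_cutWt_le h1.le r))
      (ne_top_of_le_ne_top (ENNReal.mul_ne_top hMt hui) hJM)
  have e2 : ∫⁻ x in {x | R < |x|}, excOp G (n + 2) u (x, 0) ≤
      (((n + 1 + 1 : ℕ) + 1) * (tailMass G r * M)) * ∫⁻ x, u x := by
    have hmass : (∫⁻ x, cutWt G r x) + tailMass G r = 1 := by
      rw [← lintegral_tail_indicator, ← lintegral_add_left hcm]
      simp only [cutWt_add, h1]
    have hup : ∫⁻ x, excOp G (n + 2) u (x, 0) ≤ (∫⁻ x, cutWt G r x) * J +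
        (((n + 1 + 1 : ℕ) + 1) * (tailMass G r * M)) * ∫⁻ x, u x := by
      rw [hall]
      calc ∫⁻ b, u b * excOp G (n + 1) (fun _ => 1) (0, b)
          ≤ ∫⁻ b, (u b * excOp (cutWt G r) (n + 1) (fun _ => 1) (0, b) +
              u b * (((n + 1 : ℕ) + 1) * (tailMass G r * M))) := by
            refine lintegral_mono fun b => ?_
            rw [← mul_add]
            exact mul_le_mul' le_rfl (excOp_one_le_cutWt_add hG h1.le hM r n (0, b))
        _ = 1 * J + (∫⁻ x, u x) * (((n + 1 : ℕ) + 1) * (tailMass G r * M)) := by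
            rw [lintegral_add_left hmm, lintegral_mul_const _ hu, one_mul]
        _ = (∫⁻ x, cutWt G r x) * J + tailMass G r * J +
            (∫⁻ x, u x) * (((n + 1 : ℕ) + 1) * (tailMass G r * M)) := by
            rw [← add_mul, hmass]
        _ ≤ (∫⁻ x, cutWt G r x) * J + tailMass G r * (M * ∫⁻ x, u x) +
            (∫⁻ x, u x) * (((n + 1 : ℕ) + 1) * (tailMass G r * M)) := by gcongr
        _ = _ := by push_cast; ring
    have hlow : (∫⁻ x, cutWt G r x) * J + ∫⁻ x in {x | R < |x|}, excOp G (n + 2) u (x, 0) ≤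
        ∫⁻ x, excOp G (n + 2) u (x, 0) := by
      have hsplit := lintegral_add_compl (μ := volume) (fun x => excOp G (n + 2) u (x, 0))
        (measurableSet_lt_abs R)
      have hsplit' := lintegral_add_compl (μ := volume)
        (fun x => excOp (cutWt G r) (n + 2) u (x, 0)) (measurableSet_lt_abs R)
      have h0 : ∫⁻ x in {x | R < |x|}, excOp (cutWt G r) (n + 2) u (x, 0) = 0 := by
        rw [setLIntegral_congr_fun (g := fun _ => 0) (measurableSet_lt_abs R) fun x hx =>
          excOp_cutWt_apply_zero_eq_zero hR hx (n + 1)]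
        simp
      rw [← hcut, ← hsplit, ← hsplit', h0, zero_add, add_comm]
      exact add_le_add le_rfl (lintegral_mono fun x => excOp_mono (cutWt_le G r) (fun _ => le_rfl) _ _)
    exact (ENNReal.add_le_add_iff_left hJt).1 (hlow.trans hup)
  rw [tailTerm]
  rcases le_total (ENNReal.ofReal (C / (((n + 1 : ℕ) + 1) * √((n + 1 : ℕ) + 1))))
    (((n + 1 + 1 : ℕ) + 1) * (tailMass G (R / ((n + 1 : ℕ) + 2)) * M)) with h | h
  · rw [min_eq_left h]; exact e1
  · rw [min_eq_right h]; exact e2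

lemma lintegral_excOp_first_tail_le (hG : Measurable G) {a : ℝ≥0∞} (hua : ∀ x, u x ≤ a) (R : ℝ) :
    ∫⁻ x in {x | R < |x|}, excOp G 1 u (x, 0) ≤
      tailMass (fun x => excOp G 1 (fun _ => 1) (x, 0)) R * a := by
  unfold tailMass
  rw [← lintegral_mul_const _ (measurable_excOp_zero hG measurable_const 1)]
  refine lintegral_mono fun x => ?_
  rw [mul_comm, ← excOp_const_mul hG measurable_const]
  exact excOp_mono (fun _ => le_rfl) (fun y => by simpa using hua y) _ _

end Tails

variable {E : ℝ → ℝ}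

/-- Uniform decay of the excursion operator away from the origin. -/
lemma exists_bOp_tail (hE : IsStepDensity E) : ∃ s : ℝ → ℝ≥0∞, Tendsto s atTop (𝓝 0) ∧
    (∀ R x : ℝ, 0 ≤ R → R < |x| → bOp (wt E) 1 (fun _ => 1) x ≤ s R) ∧
    ∀ R : ℝ, 0 ≤ R → ∀ u : ℝ → ℝ≥0∞, Measurable u → ∫⁻ x, u x ≠ ∞ → ∀ a : ℝ≥0∞, (∀ x, u x ≤ a) →
      ∫⁻ x in {x | R < |x|}, bOp (wt E) 1 u x ≤ s R * (∫⁻ x, u x) + s R * a := by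
  have hG := hE.measurable_wt
  have h1 := hE.lintegral_wt
  obtain ⟨M, -, hM⟩ := hE.exists_wt_le
  obtain ⟨C, hC0, hC⟩ := exists_excOp_one_le hE
  set κ : ℝ → ℝ≥0∞ := fun x => excOp (wt E) 1 (fun _ => 1) (x, 0) with hκ
  have hκm : Measurable κ := measurable_excOp_zero hG measurable_const 1
  have hκi : ∫⁻ x, κ x ≠ ∞ := by
    rw [hκ, lintegral_excOp_succ hG measurable_const 0, h1, one_mul]
    simp only [excOp_zero, pinOp, mul_one, one_mul, zero_sub, ← neg_mul]
    rw [lintegral_comp_mul_left hG (by norm_num), h1]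
    simp
  refine ⟨fun R => ∑' n, tailTerm (wt E) C M R n + tailMass κ R, ?_, fun R x hR hx => ?_,
    fun R hR u hu hui a ha => ?_⟩
  · simpa using (tendsto_tsum_tailTerm hG (by simp [h1]) C ENNReal.coe_ne_top).add
      (tendsto_tailMass hκm hκi)
  · refine le_add_right (ENNReal.tsum_le_tsum fun n => ?_)
    rw [one_pow, one_mul]
    exact excOp_one_tail_le hG h1.le hM hC0.le hC hR hx n
  · unfold bOp
    simp only [one_pow, one_mul]
    rw [lintegral_tsum fun n => (measurable_excOp_zero hG hu (n + 1)).aemeasurable,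
      tsum_eq_zero_add' ENNReal.summable, add_comm]
    refine add_le_add ?_ ?_
    · calc _ ≤ ∑' n, tailTerm (wt E) C M R (n + 1) * ∫⁻ x, u x :=
            ENNReal.tsum_le_tsum fun n =>
              lintegral_excOp_tail_le hG h1 hM ENNReal.coe_ne_top hC hu hui hR n
        _ = (∑' n, tailTerm (wt E) C M R (n + 1)) * ∫⁻ x, u x := ENNReal.tsum_mul_right
        _ ≤ _ := by
            refine mul_le_mul' (le_add_right ?_) le_rfl
            rw [tsum_eq_zero_add' (f := tailTerm (wt E) C M R) ENNReal.summable]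
            exact le_add_self
    · refine (lintegral_excOp_first_tail_le hG ha R).trans (mul_le_mul' le_add_self le_rfl)

lemma exists_bOp_one_le (hE : IsStepDensity E) :
    ∃ B : ℝ≥0∞, B ≠ ∞ ∧ ∀ x, bOp (wt E) 1 (fun _ => 1) x ≤ B := by
  obtain ⟨C, hC0, hC⟩ := exists_excOp_one_le hE
  refine ⟨_, tsum_three_halves_ne_top C, fun x => ENNReal.tsum_le_tsum fun n => ?_⟩
  rw [one_pow, one_mul]
  refine (hC (n + 1) _).trans (ENNReal.ofReal_le_ofReal ?_)
  push_cast
  gcongr <;> linarith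

end

section

section LowerBound

/-- The end points `y` whose reference path `k ↦ p k y` (read backwards in time) is `η`-close to
the state `z` when `k` free steps remain. -/
def tubeSet (p : ℕ → ℝ → ℝ) (R η : ℝ) (k : ℕ) (z : ℝ × ℝ) : Set ℝ :=
  {y | |y| ≤ R ∧ |z.1 - p (k + 1) y| ≤ η ∧ |z.2 - p k y| ≤ η}

variable {G : ℝ → ℝ≥0∞} {u : ℝ → ℝ≥0∞} {p : ℕ → ℝ → ℝ} {R η r e : ℝ}

lemma measurable_indicator_tubeSet (hp : ∀ k, Measurable (p k)) (hu : Measurable u) (k : ℕ) (b : ℝ) :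
    Measurable fun w : ℝ × ℝ => (tubeSet p R η k (b, w.1)).indicator u w.2 := by
  have hs : MeasurableSet {w : ℝ × ℝ | |w.2| ≤ R ∧ |b - p (k + 1) w.2| ≤ η ∧ |w.1 - p k w.2| ≤ η} := by
    have h1 : Measurable fun w : ℝ × ℝ => |w.2| := measurable_snd.abs
    have h2 : Measurable fun w : ℝ × ℝ => |b - p (k + 1) w.2| :=
      (measurable_const.sub ((hp (k + 1)).comp measurable_snd)).abs
    have h3 : Measurable fun w : ℝ × ℝ => |w.1 - p k w.2| :=
      (measurable_fst.sub ((hp k).comp measurable_snd)).abs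
    exact (measurableSet_le h1 measurable_const).inter
      ((measurableSet_le h2 measurable_const).inter (measurableSet_le h3 measurable_const))
  exact (hu.comp measurable_snd).indicator hs

/-- Lower bound on the excursion operator along a tube around a reference path. -/
lemma le_excOp_of_path (hG : Measurable G) (he : ∀ x, |x| ≤ 8 * η → ENNReal.ofReal e ≤ G x)
    (hp : ∀ k, Measurable (p k)) (hu : Measurable u) (hη : 0 ≤ η) {n : ℕ}
    (hp0 : ∀ y, p 0 y = y) (hp1 : ∀ y, |y| ≤ R → |p 1 y - 2 * p 0 y| ≤ 4 * η)
    (hp2 : ∀ k, k < n → ∀ y, |y| ≤ R → |p k y + p (k + 2) y - 2 * p (k + 1) y| ≤ 4 * η)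
    (k : ℕ) (hk : k < n) (z : ℝ × ℝ) :
    ENNReal.ofReal e ^ 2 * (ENNReal.ofReal (2 * η) * ENNReal.ofReal e) ^ k *
      ∫⁻ y, (tubeSet p R η (k + 1) z).indicator u y ≤ excOp G (k + 1) u z := by
  have hmz : ∀ (k : ℕ) (z : ℝ × ℝ), Measurable ((tubeSet p R η k z).indicator u) := fun k z =>
    (measurable_indicator_tubeSet hp hu k z.1).comp
      (by fun_prop : Measurable fun y : ℝ => (z.2, y))
  induction k generalizing z with
  | zero =>
    rw [pow_zero, mul_one, ← lintegral_const_mul _ (hmz _ _), excOp_succ, excOp_zero]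
    refine lintegral_mono fun y => ?_
    by_cases hy : y ∈ tubeSet p R η (0 + 1) z
    · rw [indicator_of_mem hy, pinOp, sq, mul_assoc]
      obtain ⟨h1, h2, h3⟩ := hy
      have h4 := hp1 y h1
      have h5 := hp2 0 hk y h1
      rw [hp0] at h4 h5
      rw [abs_le] at h1 h2 h3 h4 h5
      refine mul_le_mul' (he _ (abs_le.2 ?_)) (mul_le_mul' (he _ (abs_le.2 ?_)) le_rfl) <;>
        constructor <;> linarith
    · rw [indicator_of_notMem hy, mul_zero]; exact zero_le
  | succ k ih =>
    set c := ENNReal.ofReal e ^ 2 * (ENNReal.ofReal (2 * η) * ENNReal.ofReal e) ^ k with hc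
    rw [excOp_succ]
    calc ENNReal.ofReal e ^ 2 * (ENNReal.ofReal (2 * η) * ENNReal.ofReal e) ^ (k + 1) *
          ∫⁻ y, (tubeSet p R η (k + 2) z).indicator u y
        = ∫⁻ y, c * (ENNReal.ofReal (2 * η) * ENNReal.ofReal e) *
            (tubeSet p R η (k + 2) z).indicator u y := by
          rw [lintegral_const_mul _ (hmz _ _), pow_succ _ k, ← mul_assoc (ENNReal.ofReal e ^ 2)]
      _ ≤ ∫⁻ y, ∫⁻ d, G (d + z.1 - 2 * z.2) *
            (c * (tubeSet p R η (k + 1) (z.2, d)).indicator u y) := by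
          refine lintegral_mono fun y => ?_
          by_cases hy : y ∈ tubeSet p R η (k + 2) z
          · rw [indicator_of_mem hy]
            calc c * (ENNReal.ofReal (2 * η) * ENNReal.ofReal e) * u y
                = ∫⁻ d, (Icc (p (k + 1) y - η) (p (k + 1) y + η)).indicator
                    (fun _ => ENNReal.ofReal e * (c * u y)) d := by
                  rw [lintegral_indicator measurableSet_Icc, setLIntegral_const, Real.volume_Icc]
                  rw [show p (k + 1) y + η - (p (k + 1) y - η) = 2 * η by ring]
                  ring
              _ ≤ _ := by
                  refine lintegral_mono fun d => ?_
                  by_cases hd : d ∈ Icc (p (k + 1) y - η) (p (k + 1) y + η)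
                  · obtain ⟨h1, h2, h3⟩ := hy
                    have h5 := hp2 (k + 1) hk y h1
                    rw [indicator_of_mem hd, indicator_of_mem]
                    · refine mul_le_mul' (he _ ?_) le_rfl
                      rw [abs_le] at *
                      constructor <;> linarith [hd.1, hd.2]
                    · exact ⟨h1, h3, abs_le.2 ⟨by linarith [hd.1], by linarith [hd.2]⟩⟩
                  · rw [indicator_of_notMem hd]; exact zero_le
          · rw [indicator_of_notMem hy, mul_zero]; exact zero_le
      _ = ∫⁻ d, G (d + z.1 - 2 * z.2) *
            (c * ∫⁻ y, (tubeSet p R η (k + 1) (z.2, d)).indicator u y) := by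
          rw [lintegral_lintegral_swap]
          · refine lintegral_congr fun d => ?_
            rw [lintegral_const_mul _ ((hmz _ _).const_mul _), lintegral_const_mul _ (hmz _ _)]
          · have h1 := (measurable_indicator_tubeSet (R := R) (η := η) hp hu (k + 1) z.2).comp
              measurable_swap
            exact (((hG.comp (by fun_prop : Measurable fun w : ℝ × ℝ => w.2 + z.1 - 2 * z.2)).mul
              (h1.const_mul c))).aemeasurable
      _ ≤ stepOp G (excOp G (k + 1) u) z :=
          lintegral_mono fun d => mul_le_mul' le_rfl (ih (by omega) (z.2, d))

/-- The cubic reference path from the state `(x, 0)` to the state `(y, 0)` in `n + 1` steps, read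
backwards in time. -/
def cubicPath (n : ℕ) (x : ℝ) (k : ℕ) (y : ℝ) : ℝ :=
  y * (((n : ℝ) - k) * (n - k + 1) * (k + 1) / (n * (n + 1))) -
    x * (((n : ℝ) - k) * k * (k + 1) / ((n + 1) * (n + 2)))

lemma abs_second_diff_cubicPath_le {n : ℕ} (hn : 1 ≤ n) {x y : ℝ} (hx : |x| ≤ R) (hy : |y| ≤ R)
    {t d : ℝ} (ht0 : 0 ≤ t) (htn : t ≤ n)
    (hd : d = y * ((6 * t - 4 * n) / (n * (n + 1))) +
      x * ((6 * t + 2 * (1 - n)) / ((n + 1) * (n + 2)))) : |d| ≤ 12 * R / (n + 1) := by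
  have hn' : (1 : ℝ) ≤ n := by exact_mod_cast hn
  have h1 : |(6 * t - 4 * n) / (n * (n + 1))| ≤ 6 / ((n : ℝ) + 1) := by
    rw [abs_div, abs_of_pos (by positivity : (0 : ℝ) < n * (n + 1)),
      div_le_div_iff₀ (by positivity) (by positivity)]
    have : |6 * t - 4 * n| ≤ 6 * n := abs_le.2 ⟨by linarith, by linarith⟩
    nlinarith
  have h2 : |(6 * t + 2 * (1 - n)) / ((n + 1) * (n + 2))| ≤ 6 / ((n : ℝ) + 1) := by
    rw [abs_div, abs_of_pos (by positivity : (0 : ℝ) < (n + 1) * (n + 2)),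
      div_le_div_iff₀ (by positivity) (by positivity)]
    have : |6 * t + 2 * (1 - n)| ≤ 6 * (n + 2) := abs_le.2 ⟨by linarith, by linarith⟩
    nlinarith
  calc |d| ≤ |y| * |(6 * t - 4 * n) / (n * (n + 1))| +
        |x| * |(6 * t + 2 * (1 - n)) / ((n + 1) * (n + 2))| := by
        rw [hd, ← abs_mul, ← abs_mul]; exact abs_add_le _ _
    _ ≤ R * (6 / ((n : ℝ) + 1)) + R * (6 / ((n : ℝ) + 1)) := by gcongr <;> exact (abs_nonneg _).trans ‹_›
    _ = _ := by ring

end LowerBound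

/-- Excursions between bounded slopes have uniformly positive weight. -/
lemma exists_le_excOp {E : ℝ → ℝ} (hE : IsStepDensity E) (R : ℝ) :
    ∃ n : ℕ, ∃ c : ℝ, 0 < c ∧ ∀ x, |x| ≤ R → ∀ u : ℝ → ℝ≥0∞, Measurable u →
      ENNReal.ofReal c * ∫⁻ y in {y | |y| ≤ R}, u y ≤ excOp (wt E) (n + 1) u (x, 0) := by
  obtain ⟨e, r, he, hr, hEr⟩ := hE.exists_le_wt
  obtain ⟨m, hm⟩ := exists_nat_gt (24 * R / r)
  set n := m + 1 with hn
  have hnm : ((n : ℕ) : ℝ) = m + 1 := by rw [hn]; push_cast; ring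
  set η := r / 8 with hη
  have hbd : 12 * R / ((n : ℝ) + 1) ≤ 4 * η := by
    rw [div_lt_iff₀ hr] at hm
    rw [div_le_iff₀ (by positivity), hη, hnm]
    nlinarith
  refine ⟨m, e ^ 2 * (2 * η * e) ^ m, by positivity, fun x hx u hu => ?_⟩
  have hn0 : (n : ℝ) ≠ 0 := by rw [hnm]; positivity
  have hn1 : (n : ℝ) + 1 ≠ 0 := by rw [hnm]; positivity
  have hn2 : (n : ℝ) + 2 ≠ 0 := by rw [hnm]; positivity
  have key := le_excOp_of_path (R := R) (η := η) (e := e) (p := cubicPath n x) (n := n)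
    hE.measurable_wt (fun y hy => hEr y (by rw [hη] at hy; linarith))
    (fun k => by unfold cubicPath; fun_prop) hu (by positivity)
    (fun y => by unfold cubicPath; field_simp; push_cast; ring)
    (fun y hy => (abs_second_diff_cubicPath_le (t := 0) (by omega) hx hy le_rfl (by positivity)
      (by unfold cubicPath; field_simp; push_cast; ring)).trans hbd)
    (fun k hk y hy => (abs_second_diff_cubicPath_le (t := k + 1) (by omega) hx hy (by positivity)
      (by exact_mod_cast hk) (by unfold cubicPath; field_simp; push_cast; ring)).trans hbd)
    m (by omega) (x, 0)
  refine le_trans (le_of_eq ?_) key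
  rw [ENNReal.ofReal_mul (by positivity), ENNReal.ofReal_pow he.le, ENNReal.ofReal_pow (by positivity),
    ENNReal.ofReal_mul (by positivity)]
  congr 1
  rw [← lintegral_indicator (measurableSet_abs_le R)]
  congr 1
  ext y
  have e1 : cubicPath n x (m + 1 + 1) y = x := by
    unfold cubicPath; rw [hn] at *; push_cast at *; field_simp; ring
  have e2 : cubicPath n x (m + 1) y = 0 := by
    unfold cubicPath; rw [hn] at *; push_cast; simp
  have hmem : y ∈ tubeSet (cubicPath n x) R η (m + 1) (x, 0) ↔ y ∈ {y | |y| ≤ R} := by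
    simp only [tubeSet, mem_ofPred_eq, e1, e2, sub_self, abs_zero, (by positivity : 0 ≤ η), and_self,
      and_true]
  by_cases hy : y ∈ {y | |y| ≤ R}
  · rw [indicator_of_mem hy, indicator_of_mem (hmem.2 hy)]
  · rw [indicator_of_notMem hy, indicator_of_notMem fun h => hy (hmem.1 h)]

end

section

/-- The partition function with `k` sites left to integrate, started from the state
`z = (φ_{n-1}, φ_n)`. -/
def partFn (G : ℝ → ℝ≥0∞) (ε : ℝ≥0∞) : ℕ → ℝ × ℝ → ℝ≥0∞
  | 0 => pinOp G G
  | k + 1 => fun z => stepOp G (partFn G ε k) z + ε * pinOp G (fun x => partFn G ε k (x, 0)) z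

section PartFn

variable {G : ℝ → ℝ≥0∞} {ε : ℝ≥0∞}

lemma measurable_partFn (hG : Measurable G) (k : ℕ) : Measurable (partFn G ε k) := by
  induction k with
  | zero => exact measurable_pinOp hG hG
  | succ k ih =>
    exact (measurable_stepOp hG ih).add ((measurable_pinOp hG
      (ih.comp (by fun_prop : Measurable fun x : ℝ => (x, (0 : ℝ))))).const_mul ε)

lemma partFn_ne_top (hG : Measurable G) (h1 : ∫⁻ x, G x ≤ 1) {M : ℝ≥0} (hM : ∀ x, G x ≤ M)
    (hε : ε ≠ ∞) (k : ℕ) (z : ℝ × ℝ) : partFn G ε k z ≠ ∞ := by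
  suffices h : ∃ K : ℝ≥0∞, K ≠ ∞ ∧ ∀ z, partFn G ε k z ≤ K by
    obtain ⟨K, hK, h⟩ := h
    exact ne_top_of_le_ne_top hK (h z)
  induction k with
  | zero => exact ⟨M * M, by finiteness, fun z => mul_le_mul' (hM _) (hM _)⟩
  | succ k ih =>
    obtain ⟨K, hK, h⟩ := ih
    refine ⟨1 * K + ε * (M * K), by finiteness, fun z => ?_⟩
    exact add_le_add (stepOp_le_of_le hG h1 h z) (mul_le_mul' le_rfl (mul_le_mul' (hM _) (h _)))

/-- The weight of the path that continues the state `z` by the heights `φ` and ends at `(0, 0)`. -/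
def chainWt (G : ℝ → ℝ≥0∞) : (k : ℕ) → ℝ × ℝ → (Fin k → ℝ) → ℝ≥0∞
  | 0, z, _ => pinOp G G z
  | k + 1, z, φ => G (φ 0 + z.1 - 2 * z.2) * chainWt G k (z.2, φ 0) (Fin.tail φ)

lemma measurable_chainWt (hG : Measurable G) (k : ℕ) :
    Measurable fun w : (ℝ × ℝ) × (Fin k → ℝ) => chainWt G k w.1 w.2 := by
  induction k with
  | zero => exact (measurable_pinOp hG hG).comp measurable_fst
  | succ k ih =>
    have h2 : Measurable fun w : (ℝ × ℝ) × (Fin (k + 1) → ℝ) => ((w.1.2, w.2 0), Fin.tail w.2) := by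
      unfold Fin.tail
      fun_prop
    exact (hG.comp (by fun_prop : Measurable fun w : (ℝ × ℝ) × (Fin (k + 1) → ℝ) =>
      w.2 0 + w.1.1 - 2 * w.1.2)).mul (ih.comp h2)

instance sigmaFinite_pinFactor (ε : ℝ) : SigmaFinite (pinFactor ε) := by
  unfold pinFactor
  have : IsFiniteMeasure (ENNReal.ofReal ε • Measure.dirac (0 : ℝ)) :=
    ⟨by simp⟩
  infer_instance

lemma lintegral_pinFactor (ε : ℝ) (f : ℝ → ℝ≥0∞) :
    ∫⁻ x, f x ∂(pinFactor ε) = (∫⁻ x, f x) + ENNReal.ofReal ε * f 0 := by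
  rw [pinFactor, lintegral_add_measure, lintegral_smul_measure, lintegral_dirac, smul_eq_mul,
    add_comm]

lemma lintegral_chainWt (hG : Measurable G) (ε : ℝ) (k : ℕ) (z : ℝ × ℝ) :
    ∫⁻ φ, chainWt G k z φ ∂(Measure.pi fun _ : Fin k => pinFactor ε) =
      partFn G (ENNReal.ofReal ε) k z := by
  induction k generalizing z with
  | zero =>
    rw [Measure.pi_of_empty, lintegral_dirac]
    rfl
  | succ k ih =>
    have hmp := measurePreserving_piFinSuccAbove (fun _ : Fin (k + 1) => pinFactor ε) 0
    have hm : Measurable fun w : ℝ × (Fin k → ℝ) =>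
        G (w.1 + z.1 - 2 * z.2) * chainWt G k (z.2, w.1) w.2 :=
      (hG.comp (by fun_prop : Measurable fun w : ℝ × (Fin k → ℝ) => w.1 + z.1 - 2 * z.2)).mul
        ((measurable_chainWt hG k).comp
          (by fun_prop : Measurable fun w : ℝ × (Fin k → ℝ) => ((z.2, w.1), w.2)))
    have h1 := hmp.lintegral_comp hm
    have h2 : ∀ c, Measurable (chainWt G k (z.2, c)) := fun c =>
      (measurable_chainWt hG k).comp (by fun_prop : Measurable fun φ : Fin k → ℝ => ((z.2, c), φ))
    refine Eq.trans h1 ?_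
    rw [lintegral_prod _ hm.aemeasurable]
    simp only [lintegral_const_mul _ (h2 _), ih]
    rw [lintegral_pinFactor]
    simp only [zero_add]
    rfl

/-- The height sequence `a, b, φ_0, …, φ_{k-1}, 0, 0, …`. -/
def heightSeq {k : ℕ} (z : ℝ × ℝ) (φ : Fin k → ℝ) : ℕ → ℝ
  | 0 => z.1
  | 1 => z.2
  | i + 2 => if h : i < k then φ ⟨i, h⟩ else 0

lemma heightSeq_succ {k : ℕ} (z : ℝ × ℝ) (φ : Fin (k + 1) → ℝ) (i : ℕ) :
    heightSeq z φ (i + 1) = heightSeq (z.2, φ 0) (Fin.tail φ) i := by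
  match i with
  | 0 => rfl
  | 1 => simp [heightSeq]
  | i + 2 => simp [heightSeq, Fin.tail]

lemma chainWt_eq_prod (G : ℝ → ℝ≥0∞) (k : ℕ) (z : ℝ × ℝ) (φ : Fin k → ℝ) :
    chainWt G k z φ = ∏ n ∈ Finset.range (k + 2),
      G (heightSeq z φ (n + 2) + heightSeq z φ n - 2 * heightSeq z φ (n + 1)) := by
  induction k generalizing z with
  | zero => simp [chainWt, Finset.prod_range_succ, heightSeq, pinOp]
  | succ k ih =>
    rw [chainWt, ih, Finset.prod_range_succ' _ (k + 2), mul_comm]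
    simp only [← heightSeq_succ]
    simp [heightSeq]

lemma fieldExt_eq_heightSeq (k : ℕ) (φ : Fin k → ℝ) (i : ℕ) :
    fieldExt (k + 1) φ ((i : ℤ) - 1) = heightSeq (0, 0) φ i := by
  match i with
  | 0 => simp [fieldExt, heightSeq]
  | 1 => simp [fieldExt, heightSeq]
  | i + 2 =>
    have e : ((i + 2 : ℕ) : ℤ) - 1 = (i : ℤ) + 1 := by push_cast; ring
    rw [e, fieldExt, heightSeq]
    by_cases h : i < k
    · rw [dif_pos h, dif_pos ⟨by omega, by push_cast; omega⟩]
      congr 1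
    · rw [dif_neg h, dif_neg (by push_cast; omega)]

lemma hamWeight_eq_prod (E : ℝ → ℝ) (k : ℕ) (φ : Fin k → ℝ) :
    hamWeight E (k + 1) φ = ∏ n ∈ Finset.range (k + 2),
      E (heightSeq (0, 0) φ (n + 2) + heightSeq (0, 0) φ n - 2 * heightSeq (0, 0) φ (n + 1)) := by
  unfold hamWeight
  symm
  refine Finset.prod_nbij (fun n : ℕ => (n : ℤ)) (fun n hn => ?_) (fun a _ b _ h => ?_)
    (fun n hn => ?_) (fun n _ => ?_)
  · rw [Finset.mem_range] at hn
    rw [Finset.mem_Icc]; push_cast; omega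
  · exact Int.ofNat_injective h
  · rw [Finset.mem_coe, Finset.mem_Icc] at hn
    push_cast at hn
    exact ⟨n.toNat, by rw [Finset.mem_coe, Finset.mem_range]; omega, by simp; omega⟩
  · rw [← fieldExt_eq_heightSeq, ← fieldExt_eq_heightSeq, ← fieldExt_eq_heightSeq]
    congr 4
    · push_cast; ring
    · push_cast; ring

end PartFn

variable {E : ℝ → ℝ}

lemma Zpin_succ_eq (hE : IsStepDensity E) (ε : ℝ) (k : ℕ) :
    Zpin E ε (k + 1) = (partFn (wt E) (ENNReal.ofReal ε) k (0, 0)).toReal := by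
  have hm : Measurable fun φ : Fin k → ℝ => hamWeight E (k + 1) φ := by
    simp only [hamWeight_eq_prod]
    have hh : ∀ i, Measurable fun φ : Fin k → ℝ => heightSeq (0, 0) φ i := fun i => by
      match i with
      | 0 => exact measurable_const
      | 1 => exact measurable_const
      | i + 2 =>
        by_cases h : i < k
        · simpa [heightSeq, h] using measurable_pi_apply _
        · simp [heightSeq, h]
    exact Finset.measurable_prod _ fun n _ => hE.cont.measurable.comp
      (((hh _).add (hh _)).sub ((hh _).const_mul 2))
  have hnn : ∀ φ : Fin k → ℝ, 0 ≤ hamWeight E (k + 1) φ := fun φ =>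
    Finset.prod_nonneg fun n _ => hE.nonneg _
  have h := integral_eq_lintegral_of_nonneg_ae (μ := Measure.pi fun _ : Fin k => pinFactor ε)
    (ae_of_all _ hnn) hm.aestronglyMeasurable
  refine Eq.trans h ?_
  rw [← lintegral_chainWt hE.measurable_wt]
  congr 1
  refine lintegral_congr fun φ => ?_
  rw [hamWeight_eq_prod, chainWt_eq_prod, ENNReal.ofReal_prod_of_nonneg fun n _ => hE.nonneg _]
  rfl

end

section

variable {G : ℝ → ℝ≥0∞} {q ε : ℝ≥0∞}

section Renewal

lemma stepOp_sum (hG : Measurable G) {f : ℕ → ℝ × ℝ → ℝ≥0∞} (hf : ∀ k, Measurable (f k)) (m : ℕ)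
    (z : ℝ × ℝ) :
    stepOp G (fun w => ∑ k ∈ Finset.range m, f k w) z = ∑ k ∈ Finset.range m, stepOp G (f k) z := by
  unfold stepOp
  simp only [Finset.mul_sum]
  refine lintegral_finsetSum _ fun k _ => ?_
  have := hf k
  fun_prop

/-- Minimality of the discounted Green series. -/
lemma tsum_pow_mul_excOp_le (hG : Measurable G) {w : ℝ → ℝ≥0∞} (hw : Measurable w)
    {f : ℝ × ℝ → ℝ≥0∞} (hf : ∀ z, pinOp G w z + q * stepOp G f z ≤ f z) (z : ℝ × ℝ) :
    ∑' n, q ^ n * excOp G n w z ≤ f z := by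
  refine ENNReal.tsum_le_of_sum_range_le fun m => ?_
  induction m generalizing z with
  | zero => simp
  | succ m ih =>
    have hm : ∀ n, Measurable fun z => q ^ n * excOp G n w z := fun n =>
      (measurable_excOp hG hw n).const_mul _
    calc ∑ n ∈ Finset.range (m + 1), q ^ n * excOp G n w z
        = pinOp G w z + q * stepOp G (fun y => ∑ n ∈ Finset.range m, q ^ n * excOp G n w y) z := by
          rw [Finset.sum_range_succ', stepOp_sum hG hm, Finset.mul_sum, pow_zero, one_mul, excOp_zero,
            add_comm]
          congr 1
          refine Finset.sum_congr rfl fun n _ => ?_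
          rw [stepOp_const_mul hG (measurable_excOp hG hw n), excOp_succ, pow_succ', mul_assoc]
      _ ≤ pinOp G w z + q * stepOp G f z := by
          gcongr
          exact stepOp_mono (fun _ => le_rfl) ih z
      _ ≤ f z := hf z

lemma tsum_pow_mul_excOp_apply_zero (q : ℝ≥0∞) (w : ℝ → ℝ≥0∞) (x : ℝ) :
    ∑' n, q ^ n * excOp G n w (x, 0) = G x * w 0 + bOp G q w x := by
  rw [tsum_eq_zero_add' ENNReal.summable, pow_zero, one_mul, excOp_zero, pinOp, mul_zero, sub_zero]
  rfl

/-- The discounted sum of the partition functions over all system sizes. -/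
def grandFn (G : ℝ → ℝ≥0∞) (q ε : ℝ≥0∞) (z : ℝ × ℝ) : ℝ≥0∞ := ∑' k, q ^ k * partFn G ε k z

lemma measurable_grandFn (hG : Measurable G) : Measurable (grandFn G q ε) :=
  Measurable.tsum fun k => (measurable_partFn hG k).const_mul _

lemma measurable_grandFn_zero (hG : Measurable G) : Measurable fun x => grandFn G q ε (x, 0) :=
  (measurable_grandFn hG).comp (by fun_prop : Measurable fun x : ℝ => (x, (0 : ℝ)))

lemma pinOp_add_stepOp_grandFn_le (hG : Measurable G) (z : ℝ × ℝ) :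
    pinOp G (fun x => q * ε * grandFn G q ε (x, 0)) z + q * stepOp G (grandFn G q ε) z ≤
      grandFn G q ε z := by
  conv_rhs => rw [grandFn, tsum_eq_zero_add' ENNReal.summable]
  refine le_add_left (le_of_eq ?_)
  have h1 : stepOp G (grandFn G q ε) z = ∑' k, q ^ k * stepOp G (partFn G ε k) z := by
    rw [show grandFn G q ε = fun z => ∑' k, q ^ k * partFn G ε k z from rfl,
      stepOp_tsum hG fun k => (measurable_partFn hG k).const_mul _]
    simp only [stepOp_const_mul hG (measurable_partFn hG _)]
  rw [h1, pinOp, grandFn, ← ENNReal.tsum_mul_left, ← ENNReal.tsum_mul_left, ← ENNReal.tsum_mul_left,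
    ← ENNReal.tsum_add]
  refine tsum_congr fun k => ?_
  simp only [partFn, pinOp, pow_succ]
  ring

lemma grandFn_renewal_le (hG : Measurable G) (x : ℝ) :
    q * ε * (G x * grandFn G q ε (0, 0) + bOp G q (fun y => grandFn G q ε (y, 0)) x) ≤
      grandFn G q ε (x, 0) := by
  have h := tsum_pow_mul_excOp_le hG ((measurable_grandFn_zero hG).const_mul (q * ε))
    (pinOp_add_stepOp_grandFn_le (q := q) (ε := ε) hG) (x, 0)
  rw [tsum_pow_mul_excOp_apply_zero, bOp_const_mul hG (measurable_grandFn_zero hG)] at h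
  refine le_trans (le_of_eq ?_) h
  ring

/-- The terms of the renewal series of the contact process. -/
def renewTerm (G : ℝ → ℝ≥0∞) (q t : ℝ≥0∞) : ℕ → ℝ → ℝ≥0∞
  | 0 => G
  | k + 1 => fun x => t * bOp G q (renewTerm G q t k) x

/-- The partial sums of the renewal series. -/
def renewSum (G : ℝ → ℝ≥0∞) (q t : ℝ≥0∞) (k : ℕ) (x : ℝ) : ℝ≥0∞ :=
  ∑ j ∈ Finset.range k, renewTerm G q t j x

/-- The renewal series of the contact process. -/
def renewFn (G : ℝ → ℝ≥0∞) (q t : ℝ≥0∞) (x : ℝ) : ℝ≥0∞ := ∑' j, renewTerm G q t j x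

variable {t : ℝ≥0∞}

lemma measurable_renewTerm (hG : Measurable G) (k : ℕ) : Measurable (renewTerm G q t k) := by
  induction k with
  | zero => exact hG
  | succ k ih => exact (measurable_bOp hG ih).const_mul t

lemma measurable_renewSum (hG : Measurable G) (k : ℕ) : Measurable (renewSum G q t k) :=
  Finset.measurable_sum _ fun j _ => measurable_renewTerm hG j

lemma measurable_renewFn (hG : Measurable G) : Measurable (renewFn G q t) :=
  Measurable.tsum fun j => measurable_renewTerm hG j

lemma renewSum_le_renewFn (k : ℕ) (x : ℝ) : renewSum G q t k x ≤ renewFn G q t x :=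
  ENNReal.sum_le_tsum _

lemma bOp_renewSum (hG : Measurable G) (k : ℕ) (x : ℝ) :
    bOp G q (renewSum G q t k) x = ∑ j ∈ Finset.range k, bOp G q (renewTerm G q t j) x := by
  induction k with
  | zero =>
    have h : renewSum G q t 0 = fun y => 0 * G y := by ext y; simp [renewSum]
    rw [h, bOp_const_mul hG hG]
    simp
  | succ k ih =>
    have h : renewSum G q t (k + 1) = fun y => renewSum G q t k y + renewTerm G q t k y := by
      ext y; simp [renewSum, Finset.sum_range_succ]
    rw [h, bOp_add hG (measurable_renewSum hG k), ih, Finset.sum_range_succ]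

lemma renewSum_succ (hG : Measurable G) (k : ℕ) (x : ℝ) :
    renewSum G q t (k + 1) x = G x + t * bOp G q (renewSum G q t k) x := by
  rw [bOp_renewSum hG, renewSum, Finset.sum_range_succ', Finset.mul_sum, add_comm]
  rfl

lemma renewFn_eq (hG : Measurable G) (x : ℝ) :
    renewFn G q t x = G x + t * bOp G q (renewFn G q t) x := by
  rw [show renewFn G q t = fun x => ∑' j, renewTerm G q t j x from rfl,
    bOp_tsum hG fun k => measurable_renewTerm hG k, ← ENNReal.tsum_mul_left]
  exact tsum_eq_zero_add' ENNReal.summable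

/-- A positive finite subsolution of the renewal equation bounds the renewal series at the
origin. -/
lemma mul_renewFn_zero_le_one (hG : Measurable G) {u : ℝ → ℝ≥0∞}
    (h0 : u 0 ≠ 0) (htop : u 0 ≠ ∞) (h : ∀ x, t * (G x * u 0 + bOp G q u x) ≤ u x) :
    t * renewFn G q t 0 ≤ 1 := by
  have hk : ∀ k x, t * u 0 * renewSum G q t k x ≤ u x := by
    intro k
    induction k with
    | zero => intro x; simp [renewSum]
    | succ k ih =>
      intro x
      calc t * u 0 * renewSum G q t (k + 1) x
          = t * (G x * u 0 + t * u 0 * bOp G q (renewSum G q t k) x) := by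
            rw [renewSum_succ hG]; ring
        _ ≤ t * (G x * u 0 + bOp G q u x) := by
            gcongr
            rw [← bOp_const_mul hG (measurable_renewSum hG k)]
            exact bOp_mono le_rfl ih x
        _ ≤ u x := h x
  have h1 : t * u 0 * renewFn G q t 0 ≤ u 0 := by
    rw [renewFn, ← ENNReal.tsum_mul_left]
    refine ENNReal.tsum_le_of_sum_range_le fun k => ?_
    rw [← Finset.mul_sum]
    exact hk k 0
  refine (ENNReal.mul_le_mul_iff_right h0 htop).1 ?_
  calc u 0 * (t * renewFn G q t 0) = t * u 0 * renewFn G q t 0 := by ring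
    _ ≤ u 0 * 1 := by rwa [mul_one]

/-- A supersolution of the undiscounted renewal equation bounds all partition functions. -/
lemma mul_partFn_le_of_supersolution (hG : Measurable G) {v : ℝ → ℝ≥0∞} (hv : Measurable v)
    (hGv : ∀ x, G x ≤ v x) (h : ∀ x, ε * (G x * v 0 + bOp G 1 v x) ≤ v x) (k : ℕ) :
    ε * partFn G ε k (0, 0) ≤ v 0 := by
  set f : ℝ × ℝ → ℝ≥0∞ := fun z => ∑' n, excOp G n v z with hf
  have hf0 : ∀ x, ε * f (x, 0) ≤ v x := fun x => by
    have := tsum_pow_mul_excOp_apply_zero (G := G) 1 v x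
    simp only [one_pow, one_mul] at this
    rw [hf]; simp only [this]; exact h x
  have hfe : ∀ z, f z = pinOp G v z + stepOp G f z := fun z => by
    rw [hf, stepOp_tsum hG fun n => measurable_excOp hG hv n]
    simp only [← excOp_succ]
    exact tsum_eq_zero_add' ENNReal.summable
  have hW : ∀ z, partFn G ε k z ≤ f z := by
    induction k with
    | zero =>
      intro z
      rw [hfe]
      exact le_add_right (pinOp_mono (fun _ => le_rfl) hGv z)
    | succ k ih =>
      intro z
      rw [hfe, add_comm (pinOp G v z)]
      refine add_le_add (stepOp_mono (fun _ => le_rfl) ih z) ?_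
      calc ε * (G (z.1 - 2 * z.2) * partFn G ε k (z.2, 0))
          = G (z.1 - 2 * z.2) * (ε * partFn G ε k (z.2, 0)) := by ring
        _ ≤ G (z.1 - 2 * z.2) * v z.2 := by
            gcongr
            exact (mul_le_mul' le_rfl (ih _)).trans (hf0 _)
  exact (mul_le_mul' le_rfl (hW _)).trans (hf0 0)

end Renewal

end

section

section Series

lemma sum_range_one_div_sq_shift_le {N : ℕ} (hN : 1 ≤ N) (m : ℕ) :
    ∑ i ∈ Finset.range m, 1 / ((N : ℝ) + i + 1) ^ 2 ≤ 1 / (N : ℝ) := by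
  have hN' : (1 : ℝ) ≤ N := by exact_mod_cast hN
  suffices h : ∑ i ∈ Finset.range m, 1 / ((N : ℝ) + i + 1) ^ 2 ≤ 1 / (N : ℝ) - 1 / (N + m) by
    have : 0 ≤ 1 / ((N : ℝ) + m) := by positivity
    linarith
  induction m with
  | zero => simp
  | succ m ih =>
    rw [Finset.sum_range_succ]
    have : 1 / ((N : ℝ) + m + 1) ^ 2 ≤ 1 / (N + m) - 1 / (N + (m + 1 : ℕ)) := by
      have hp : 0 < (N : ℝ) + m := by positivity
      push_cast
      rw [← add_assoc, div_sub_div _ _ hp.ne' (by positivity), div_le_div_iff₀ (by positivity)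
        (by positivity)]
      nlinarith
    linarith

/-- The logarithmic correction: `∑ (1 - e^{-l n}) / n²` is at most of order `l log (1/l)`. -/
lemma sum_one_sub_exp_div_sq_le {l : ℝ} (hl : 0 < l) (hle : l ≤ Real.exp (-1)) (m : ℕ) :
    ∑ n ∈ Finset.range m, (1 - Real.exp (-l) ^ (n + 1)) / ((n : ℝ) + 1) ^ 2 ≤
      4 * (l * Real.log (1 / l)) := by
  set a : ℕ → ℝ := fun n => (1 - Real.exp (-l) ^ (n + 1)) / ((n : ℝ) + 1) ^ 2 with ha
  have hl1 : l ≤ 1 := hle.trans (Real.exp_le_one_iff.2 (by norm_num))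
  have hexp : ∀ n : ℕ, Real.exp (-l) ^ (n + 1) = Real.exp (-(l * (n + 1))) := fun n => by
    rw [← Real.exp_nat_mul]; congr 1; push_cast; ring
  have ha0 : ∀ n, 0 ≤ a n := fun n => by
    refine div_nonneg (sub_nonneg.2 ?_) (by positivity)
    rw [hexp]
    exact Real.exp_le_one_iff.2 (by have : 0 ≤ l * ((n : ℝ) + 1) := by positivity
                                    linarith)
  have ha1 : ∀ n, a n ≤ l * (1 / ((n : ℝ) + 1)) := fun n => by
    simp only [ha, hexp]
    rw [div_le_iff₀ (by positivity)]
    have := Real.add_one_le_exp (-(l * ((n : ℝ) + 1)))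
    have e : l * (1 / ((n : ℝ) + 1)) * ((n : ℝ) + 1) ^ 2 = l * (n + 1) := by field_simp
    rw [e]; linarith
  have ha2 : ∀ n, a n ≤ 1 / ((n : ℝ) + 1) ^ 2 := fun n => by
    simp only [ha]
    gcongr
    have : 0 ≤ Real.exp (-l) ^ (n + 1) := by positivity
    linarith
  set N := ⌈1 / l⌉₊ with hN
  have hN1 : 1 / l ≤ N := Nat.le_ceil _
  have hN2 : (N : ℝ) < 1 / l + 1 := Nat.ceil_lt_add_one (by positivity)
  have hN0 : 1 ≤ N := Nat.one_le_iff_ne_zero.2 (Nat.ceil_pos.2 (by positivity)).ne'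
  have hNpos : (0 : ℝ) < N := by exact_mod_cast hN0
  have hlog : 1 ≤ Real.log (1 / l) := by
    rw [one_div, Real.log_inv]
    have := Real.log_le_log hl hle
    rw [Real.log_exp] at this
    linarith
  have h1 : ∑ n ∈ Finset.range N, a n ≤ l * (1 + Real.log N) := by
    calc ∑ n ∈ Finset.range N, a n ≤ ∑ n ∈ Finset.range N, l * (1 / ((n : ℝ) + 1)) :=
          Finset.sum_le_sum fun n _ => ha1 n
      _ = l * (harmonic N : ℝ) := by
          rw [← Finset.mul_sum, harmonic]
          push_cast
          simp only [one_div]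
      _ ≤ l * (1 + Real.log N) := by
          gcongr
          exact harmonic_le_one_add_log N
  have h2 : ∑ i ∈ Finset.range m, a (N + i) ≤ l := by
    calc ∑ i ∈ Finset.range m, a (N + i) ≤ ∑ i ∈ Finset.range m, 1 / ((N : ℝ) + i + 1) ^ 2 :=
          Finset.sum_le_sum fun i _ => by
            have := ha2 (N + i)
            push_cast at this
            exact this
      _ ≤ 1 / N := sum_range_one_div_sq_shift_le hN0 m
      _ ≤ l := by rw [div_le_iff₀ hNpos]; rw [div_le_iff₀ hl] at hN1; linarith
  have h3 : Real.log N ≤ 1 + Real.log (1 / l) := by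
    have e2 : (N : ℝ) ≤ Real.exp 1 * (1 / l) := by
      have : 1 ≤ 1 / l := by rw [le_div_iff₀ hl]; linarith
      have he : 2 ≤ Real.exp 1 := by have := Real.add_one_le_exp 1; linarith
      nlinarith
    have := Real.log_le_log hNpos e2
    rwa [Real.log_mul (Real.exp_ne_zero _) (by positivity), Real.log_exp] at this
  calc ∑ n ∈ Finset.range m, a n ≤ ∑ n ∈ Finset.range (N + m), a n :=
        Finset.sum_le_sum_of_subset_of_nonneg (Finset.range_mono (by omega)) fun n _ _ => ha0 n
    _ = ∑ n ∈ Finset.range N, a n + ∑ i ∈ Finset.range m, a (N + i) := Finset.sum_range_add _ _ _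
    _ ≤ l * (1 + Real.log N) + l := add_le_add h1 h2
    _ ≤ 4 * (l * Real.log (1 / l)) := by nlinarith

end Series

variable {E : ℝ → ℝ} {q t : ℝ≥0∞}

lemma exists_bOp_le (hE : IsStepDensity E) : ∃ C : ℝ≥0∞, C ≠ ∞ ∧ ∀ u : ℝ → ℝ≥0∞, Measurable u →
    ∀ x, bOp (wt E) 1 u x ≤ C * ∫⁻ y, u y := by
  obtain ⟨C, -, h⟩ := exists_excOp_le hE
  refine ⟨∑' n : ℕ, ENNReal.ofReal (C / ((n + 1 : ℕ) : ℝ) ^ 2), ?_, fun u hu x => ?_⟩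
  · have h1 : Summable fun n : ℕ => C / ((n : ℝ)) ^ 2 := by
      simpa [div_eq_mul_inv] using (Real.summable_nat_pow_inv.2 one_lt_two).mul_left C
    exact ((summable_nat_add_iff 1).2 h1).tsum_ofReal_ne_top
  · rw [bOp, ← ENNReal.tsum_mul_right]
    refine ENNReal.tsum_le_tsum fun n => ?_
    rw [one_pow, one_mul]
    exact h (n + 1) (by omega) u hu _

lemma exists_bOp_one_le_add (hE : IsStepDensity E) : ∃ C : ℝ, 0 < C ∧ ∀ l : ℝ, 0 < l →
    l ≤ Real.exp (-1) → ∀ u : ℝ → ℝ≥0∞, Measurable u → ∀ x,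
      bOp (wt E) 1 u x ≤ bOp (wt E) (ENNReal.ofReal (Real.exp (-l))) u x +
        ENNReal.ofReal (C * (l * Real.log (1 / l))) * ∫⁻ y, u y := by
  obtain ⟨C, hC, h⟩ := exists_excOp_le hE
  refine ⟨C * 4, by positivity, fun l hl hle u hu x => ?_⟩
  set p := Real.exp (-l) with hp
  have hp0 : 0 ≤ p := (Real.exp_pos _).le
  have hp1 : p ≤ 1 := Real.exp_le_one_iff.2 (by linarith)
  have hterm : ∀ n : ℕ, 0 ≤ (1 - p ^ (n + 1)) / ((n : ℝ) + 1) ^ 2 := fun n =>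
    div_nonneg (sub_nonneg.2 (pow_le_one₀ hp0 hp1)) (by positivity)
  have hsplit : ∀ n : ℕ, (1 : ℝ≥0∞) ^ (n + 1) * excOp (wt E) (n + 1) u (x, 0) ≤
      ENNReal.ofReal p ^ (n + 1) * excOp (wt E) (n + 1) u (x, 0) +
        ENNReal.ofReal (C * ((1 - p ^ (n + 1)) / ((n : ℝ) + 1) ^ 2)) * ∫⁻ y, u y := fun n => by
    have e1 : (1 : ℝ≥0∞) ^ (n + 1) = ENNReal.ofReal p ^ (n + 1) + ENNReal.ofReal (1 - p ^ (n + 1)) := by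
      rw [← ENNReal.ofReal_pow hp0, ← ENNReal.ofReal_add (by positivity)
        (sub_nonneg.2 (pow_le_one₀ hp0 hp1))]
      simp
    rw [e1, add_mul]
    refine add_le_add le_rfl ?_
    calc ENNReal.ofReal (1 - p ^ (n + 1)) * excOp (wt E) (n + 1) u (x, 0)
        ≤ ENNReal.ofReal (1 - p ^ (n + 1)) *
            (ENNReal.ofReal (C / ((n + 1 : ℕ) : ℝ) ^ 2) * ∫⁻ y, u y) := by
          gcongr
          exact h (n + 1) (by omega) u hu _
      _ = _ := by
          rw [← mul_assoc, ← ENNReal.ofReal_mul (sub_nonneg.2 (pow_le_one₀ hp0 hp1))]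
          congr 2
          push_cast
          ring
  calc bOp (wt E) 1 u x ≤ _ := ENNReal.tsum_le_tsum hsplit
    _ = bOp (wt E) (ENNReal.ofReal p) u x +
        (∑' n : ℕ, ENNReal.ofReal (C * ((1 - p ^ (n + 1)) / ((n : ℝ) + 1) ^ 2))) * ∫⁻ y, u y := by
        rw [ENNReal.tsum_add, ENNReal.tsum_mul_right]; rfl
    _ ≤ _ := by
        gcongr
        refine ENNReal.tsum_le_of_sum_range_le fun m => ?_
        rw [← ENNReal.ofReal_sum_of_nonneg fun n _ => mul_nonneg hC.le (hterm n), ← Finset.mul_sum,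
          mul_assoc]
        exact ENNReal.ofReal_le_ofReal
          (mul_le_mul_of_nonneg_left (sum_one_sub_exp_div_sq_le hl hle m) hC.le)

lemma exists_le_bOp (hE : IsStepDensity E) (R : ℝ) : ∃ c : ℝ, 0 < c ∧ ∀ q : ℝ≥0∞,
    ENNReal.ofReal (1 / 3) ≤ q → ∀ x, |x| ≤ R → ∀ u : ℝ → ℝ≥0∞, Measurable u →
      ENNReal.ofReal c * ∫⁻ y in {y | |y| ≤ R}, u y ≤ bOp (wt E) q u x := by
  obtain ⟨n, c, hc, h⟩ := exists_le_excOp hE R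
  refine ⟨(1 / 3) ^ (n + 1) * c, by positivity, fun q hq x hx u hu => ?_⟩
  rw [ENNReal.ofReal_mul (by positivity), ENNReal.ofReal_pow (by positivity), mul_assoc]
  exact (mul_le_mul' (pow_le_pow_left' hq _) (h x hx u hu)).trans
    (ENNReal.le_tsum (f := fun n : ℕ => q ^ (n + 1) * excOp (wt E) (n + 1) u (x, 0)) n)

/-- Uniform bounds on the total mass and the supremum of the renewal series. -/
lemma exists_renewFn_le (hE : IsStepDensity E) {t₀ t₁ : ℝ} (ht₀ : 0 < t₀) :
    ∃ H : ℝ≥0∞, H ≠ ∞ ∧ ∀ q t : ℝ≥0∞, ENNReal.ofReal (1 / 3) ≤ q → q ≤ 1 →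
      ENNReal.ofReal t₀ ≤ t → t ≤ ENNReal.ofReal t₁ → t * renewFn (wt E) q t 0 ≤ 1 →
      ∫⁻ x, renewFn (wt E) q t x ≤ H := by
  have hG := hE.measurable_wt
  obtain ⟨M, hM1, hM⟩ := hE.exists_wt_le
  obtain ⟨C, hC, hb⟩ := exists_bOp_le hE
  obtain ⟨s, hs, -, htail⟩ := exists_bOp_tail hE
  set T₁ := ENNReal.ofReal t₁ with hT₁
  set T₀ := ENNReal.ofReal t₀ with hT₀
  have hT₀0 : T₀ ≠ 0 := by simpa [hT₀] using ht₀
  have hT₀t : T₀ ≠ ∞ := ENNReal.ofReal_ne_top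
  have hT₁t : T₁ ≠ ∞ := ENNReal.ofReal_ne_top
  have hKt : T₁ * (1 + T₁ * C) ≠ ∞ := by finiteness
  obtain ⟨R, hR0, hRs⟩ : ∃ R : ℝ, 0 ≤ R ∧ T₁ * (1 + T₁ * C) * s R ≤ 2⁻¹ := by
    have h1 : Tendsto (fun R => T₁ * (1 + T₁ * C) * s R) atTop (𝓝 (T₁ * (1 + T₁ * C) * 0)) :=
      ENNReal.Tendsto.const_mul hs (Or.inr hKt)
    rw [mul_zero] at h1
    have h2 := h1.eventually (ge_mem_nhds (by simp : (0 : ℝ≥0∞) < 2⁻¹))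
    obtain ⟨R, h3, h4⟩ := (h2.and (eventually_ge_atTop 0)).exists
    exact ⟨R, h4, h3⟩
  obtain ⟨c, hc, hlow⟩ := exists_le_bOp hE R
  set A := (T₀ * (T₀ * ENNReal.ofReal c))⁻¹ with hA
  have hA0 : T₀ * (T₀ * ENNReal.ofReal c) ≠ 0 :=
    mul_ne_zero hT₀0 (mul_ne_zero hT₀0 (by simpa using hc))
  have hAt : A ≠ ∞ := ENNReal.inv_ne_top.2 hA0
  set H := 2 * (A + 1 + M) with hH
  have hHt : H ≠ ∞ := by finiteness
  refine ⟨H, hHt, fun q t hq hq1 ht ht1 h0 => ?_⟩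
  have hcore : ∀ k, ∫⁻ x in {x | |x| ≤ R}, renewSum (wt E) q t k x ≤ A := fun k => by
    rw [hA, ENNReal.le_inv_iff_mul_le, mul_comm]
    calc T₀ * (T₀ * ENNReal.ofReal c) * ∫⁻ x in {x | |x| ≤ R}, renewSum (wt E) q t k x
        = T₀ * (T₀ * (ENNReal.ofReal c * ∫⁻ x in {x | |x| ≤ R}, renewSum (wt E) q t k x)) := by ring
      _ ≤ t * (t * bOp (wt E) q (renewSum (wt E) q t k) 0) := by
          gcongr
          exact hlow q hq 0 (by simpa using hR0) _ (measurable_renewSum hG k)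
      _ ≤ t * renewSum (wt E) q t (k + 1) 0 := by
          rw [renewSum_succ hG]
          gcongr
          exact le_add_self
      _ ≤ 1 := (mul_le_mul' le_rfl (renewSum_le_renewFn _ _)).trans h0
  have hind : ∀ k, ∫⁻ x, renewSum (wt E) q t k x ≤ H ∧
      ∀ x, renewSum (wt E) q t k x ≤ M + T₁ * (C * H) := by
    intro k
    induction k with
    | zero => simp [renewSum]
    | succ k ih =>
      obtain ⟨ih1, ih2⟩ := ih
      have hmk := measurable_renewSum (q := q) (t := t) hG k
      constructor
      · rw [← lintegral_add_compl _ (measurableSet_abs_le R), compl_abs_le]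
        calc _ ≤ A + ∫⁻ x in {x | R < |x|}, (wt E x +
                T₁ * bOp (wt E) 1 (renewSum (wt E) q t k) x) := by
              refine add_le_add (hcore _) (lintegral_mono fun x => ?_)
              rw [renewSum_succ hG]
              gcongr
              exact bOp_mono hq1 (fun _ => le_rfl) x
          _ = A + ((∫⁻ x in {x | R < |x|}, wt E x) +
                T₁ * ∫⁻ x in {x | R < |x|}, bOp (wt E) 1 (renewSum (wt E) q t k) x) := by
              rw [lintegral_add_left hG, lintegral_const_mul _ (measurable_bOp hG hmk)]
          _ ≤ A + (1 + T₁ * (s R * H + s R * (M + T₁ * (C * H)))) := by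
              gcongr
              · exact (setLIntegral_le_lintegral _ _).trans hE.lintegral_wt.le
              · exact (htail R hR0 _ hmk (ne_top_of_le_ne_top hHt ih1) _ ih2).trans (by gcongr)
          _ = A + (1 + (T₁ * (1 + T₁ * C) * s R * H + T₁ * 1 * s R * M)) := by ring
          _ ≤ A + (1 + (2⁻¹ * H + 2⁻¹ * M)) := by
              gcongr
              refine le_trans ?_ hRs
              gcongr
              exact le_self_add
          _ ≤ A + (1 + (2⁻¹ * H + 1 * M)) := by
              gcongr
              simp
          _ = H := by
              rw [hH, ← mul_assoc, ENNReal.inv_mul_cancel two_ne_zero ENNReal.ofNat_ne_top]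
              ring
      · intro x
        rw [renewSum_succ hG]
        gcongr
        · exact hM x
        · exact (bOp_mono hq1 (fun _ => le_rfl) x).trans ((hb _ hmk x).trans (by gcongr))
  calc ∫⁻ x, renewFn (wt E) q t x = ∑' j, ∫⁻ x, renewTerm (wt E) q t j x :=
        lintegral_tsum fun j => (measurable_renewTerm hG j).aemeasurable
    _ ≤ H := by
        refine ENNReal.tsum_le_of_sum_range_le fun k => ?_
        rw [← lintegral_finsetSum _ fun j _ => measurable_renewTerm hG j]
        exact (hind k).1

/-- Uniform positivity of the renewal series near the origin. -/
lemma exists_le_renewFn (hE : IsStepDensity E) {t₀ R : ℝ} (ht₀ : 0 < t₀) (hR : 0 < R) :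
    ∃ c : ℝ, 0 < c ∧ ∀ q t : ℝ≥0∞, ENNReal.ofReal (1 / 3) ≤ q → ENNReal.ofReal t₀ ≤ t →
      ∀ x, |x| ≤ R → ENNReal.ofReal c ≤ renewFn (wt E) q t x := by
  have hG := hE.measurable_wt
  obtain ⟨c, hc, hlow⟩ := exists_le_bOp hE R
  obtain ⟨e, r, he, hr, hEr⟩ := hE.exists_le_wt
  set ρ := min r R with hρ
  have hρ0 : 0 < ρ := lt_min hr hR
  have hmass : ENNReal.ofReal (e * (2 * ρ)) ≤ ∫⁻ y in {y | |y| ≤ R}, wt E y := by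
    calc ENNReal.ofReal (e * (2 * ρ)) = ∫⁻ _ in Icc (-ρ) ρ, ENNReal.ofReal e := by
          rw [setLIntegral_const, Real.volume_Icc, ENNReal.ofReal_mul he.le]
          congr 2; ring
      _ ≤ ∫⁻ y in Icc (-ρ) ρ, wt E y := setLIntegral_mono hG fun y hy =>
          hEr y ((abs_le.2 hy).trans (min_le_left _ _))
      _ ≤ ∫⁻ y in {y | |y| ≤ R}, wt E y :=
          lintegral_mono_set fun y hy => (abs_le.2 hy).trans (min_le_right _ _)
  refine ⟨t₀ * (c * (e * (2 * ρ))), by positivity, fun q t hq ht x hx => ?_⟩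
  rw [ENNReal.ofReal_mul ht₀.le, ENNReal.ofReal_mul hc.le, renewFn_eq hG]
  refine le_add_left (mul_le_mul' ht ((mul_le_mul' le_rfl hmass).trans ((hlow q hq x hx _ hG).trans
    (bOp_mono le_rfl (fun y => ?_) x))))
  rw [renewFn_eq hG]
  exact le_self_add

end

section

variable {E : ℝ → ℝ}

/-- If the renewal series is critical or below for the reward `τ`, then a perturbation of it is a
supersolution for the slightly smaller reward `ε`. -/
lemma renewFn_supersolution (hE : IsStepDensity E) {q : ℝ≥0∞} {τ ε κ η θ B R c : ℝ} {S : ℝ≥0∞}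
    (hτ : 0 < τ) (hε : 0 ≤ ε) (hη : 0 ≤ η) (hκ : 0 ≤ κ) (hθ : 0 ≤ θ) (hεκ : ε / τ + κ = 1)
    (h0 : ENNReal.ofReal τ * renewFn (wt E) q (ENNReal.ofReal τ) 0 ≤ 1)
    (hb : ∀ x, bOp (wt E) 1 (renewFn (wt E) q (ENNReal.ofReal τ)) x ≤
      bOp (wt E) q (renewFn (wt E) q (ENNReal.ofReal τ)) x + ENNReal.ofReal η)
    (hB : ∀ x, bOp (wt E) 1 (fun _ => 1) x ≤ ENNReal.ofReal B) (hB0 : 0 ≤ B) (hR : 0 ≤ R)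
    (hS : ∀ x, R < |x| → bOp (wt E) 1 (fun _ => 1) x ≤ S) (hεS : ENNReal.ofReal ε * S ≤ 2⁻¹)
    (hc : ∀ x, |x| ≤ R → ENNReal.ofReal c ≤ renewFn (wt E) q (ENNReal.ofReal τ) x)
    (hθη : 2 * (ε * η) ≤ θ) (hκc : ε * η + ε * (θ * B) ≤ κ * c)
    (x : ℝ) :
    ENNReal.ofReal ε * (wt E x * (renewFn (wt E) q (ENNReal.ofReal τ) 0 +
        ({0}ᶜ : Set ℝ).indicator (fun _ => ENNReal.ofReal θ) 0) +
      bOp (wt E) 1 (fun y => renewFn (wt E) q (ENNReal.ofReal τ) y +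
        ({0}ᶜ : Set ℝ).indicator (fun _ => ENNReal.ofReal θ) y) x) ≤
      renewFn (wt E) q (ENNReal.ofReal τ) x +
        ({0}ᶜ : Set ℝ).indicator (fun _ => ENNReal.ofReal θ) x := by
  have hG := hE.measurable_wt
  set h := renewFn (wt E) q (ENNReal.ofReal τ) with hh
  have hhm : Measurable h := measurable_renewFn hG
  set b := bOp (wt E) 1 (fun _ => 1) x with hbdef
  have e0 : ({0}ᶜ : Set ℝ).indicator (fun _ => ENNReal.ofReal θ) 0 = 0 := by simp
  rw [e0, add_zero, bOp_add hG hhm]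
  have hind : bOp (wt E) 1 (({0}ᶜ : Set ℝ).indicator fun _ => ENNReal.ofReal θ) x ≤
      ENNReal.ofReal θ * b := by
    rw [hbdef, ← bOp_const_mul hG measurable_const]
    refine bOp_mono le_rfl (fun y => ?_) x
    rw [mul_one]
    exact indicator_le_self' (fun _ _ => zero_le) y
  have hετ : ENNReal.ofReal ε = ENNReal.ofReal (ε / τ) * ENNReal.ofReal τ := by
    rw [← ENNReal.ofReal_mul (by positivity), div_mul_cancel₀ _ hτ.ne']
  have hrest : ENNReal.ofReal ε * ENNReal.ofReal η + ENNReal.ofReal ε * (ENNReal.ofReal θ * b) ≤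
      ENNReal.ofReal κ * h x + ({0}ᶜ : Set ℝ).indicator (fun _ => ENNReal.ofReal θ) x := by
    rcases le_or_gt |x| R with hx | hx
    · refine le_add_right ?_
      calc ENNReal.ofReal ε * ENNReal.ofReal η + ENNReal.ofReal ε * (ENNReal.ofReal θ * b)
          ≤ ENNReal.ofReal ε * ENNReal.ofReal η +
            ENNReal.ofReal ε * (ENNReal.ofReal θ * ENNReal.ofReal B) := by
            gcongr
            exact hB x
        _ = ENNReal.ofReal (ε * η + ε * (θ * B)) := by
            rw [← ENNReal.ofReal_mul hε, ← ENNReal.ofReal_mul hθ, ← ENNReal.ofReal_mul hε,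
              ← ENNReal.ofReal_add (by positivity) (by positivity)]
        _ ≤ ENNReal.ofReal (κ * c) := ENNReal.ofReal_le_ofReal hκc
        _ ≤ ENNReal.ofReal κ * h x := by
            rw [ENNReal.ofReal_mul hκ]
            gcongr
            exact hc x hx
    · have hx0 : x ∈ ({0}ᶜ : Set ℝ) := by
        rintro rfl
        simp at hx
        linarith
      rw [indicator_of_mem hx0]
      refine le_add_left ?_
      calc ENNReal.ofReal ε * ENNReal.ofReal η + ENNReal.ofReal ε * (ENNReal.ofReal θ * b)
          ≤ ENNReal.ofReal (θ / 2) + ENNReal.ofReal θ * (ENNReal.ofReal ε * S) := by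
            refine add_le_add ?_ ?_
            · rw [← ENNReal.ofReal_mul hε]
              exact ENNReal.ofReal_le_ofReal (by linarith)
            · rw [mul_left_comm]
              gcongr
              exact hS x hx
        _ ≤ ENNReal.ofReal (θ / 2) + ENNReal.ofReal θ * 2⁻¹ := by gcongr
        _ = ENNReal.ofReal θ := by
            have : (2⁻¹ : ℝ≥0∞) = ENNReal.ofReal (1 / 2) := by
              rw [one_div, ENNReal.ofReal_inv_of_pos two_pos]; simp
            rw [this, ← ENNReal.ofReal_mul hθ, ← ENNReal.ofReal_add (by positivity) (by positivity)]
            congr 1; ring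
  calc ENNReal.ofReal ε * (wt E x * h 0 + (bOp (wt E) 1 h x +
        bOp (wt E) 1 (({0}ᶜ : Set ℝ).indicator fun _ => ENNReal.ofReal θ) x))
      ≤ ENNReal.ofReal ε * (wt E x * h 0 + (bOp (wt E) q h x + ENNReal.ofReal η +
          ENNReal.ofReal θ * b)) := by
        gcongr
        exact hb x
    _ = ENNReal.ofReal (ε / τ) * (wt E x * (ENNReal.ofReal τ * h 0) +
          ENNReal.ofReal τ * bOp (wt E) q h x) +
        (ENNReal.ofReal ε * ENNReal.ofReal η + ENNReal.ofReal ε * (ENNReal.ofReal θ * b)) := by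
        rw [hετ]; ring
    _ ≤ ENNReal.ofReal (ε / τ) * (wt E x * 1 + ENNReal.ofReal τ * bOp (wt E) q h x) +
        (ENNReal.ofReal κ * h x + ({0}ᶜ : Set ℝ).indicator (fun _ => ENNReal.ofReal θ) x) := by
        gcongr
    _ = (ENNReal.ofReal (ε / τ) + ENNReal.ofReal κ) * h x +
        ({0}ᶜ : Set ℝ).indicator (fun _ => ENNReal.ofReal θ) x := by
        rw [mul_one, ← renewFn_eq hG, add_mul, add_assoc]
    _ = _ := by
        rw [← ENNReal.ofReal_add (by positivity) hκ, hεκ, ENNReal.ofReal_one, one_mul]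

/-- If the free energy at `ε₀ + δ` is too small, the partition functions at `ε₀ + δ / 2` stay
bounded. -/
lemma exists_partFn_bounded (hE : IsStepDensity E) {ε₀ : ℝ} (hε₀ : 0 < ε₀) :
    ∃ A : ℝ, 0 < A ∧ ∀ δ l : ℝ, 0 < δ → δ ≤ ε₀ → 0 < l → l ≤ Real.exp (-1) →
      l * Real.log (1 / l) ≤ A * δ →
      grandFn (wt E) (ENNReal.ofReal (Real.exp (-l))) (ENNReal.ofReal (ε₀ + δ)) (0, 0) ≠ ∞ →
      ∃ K : ℝ≥0∞, K ≠ ∞ ∧ ∀ k, partFn (wt E) (ENNReal.ofReal (ε₀ + δ / 2)) k (0, 0) ≤ K := by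
  have hG := hE.measurable_wt
  obtain ⟨H, hHt, hH⟩ := exists_renewFn_le hE (t₀ := ε₀ / 3) (t₁ := 2 * ε₀) (by positivity)
  obtain ⟨C, hC, hdiff⟩ := exists_bOp_one_le_add hE
  obtain ⟨B, hBt, hB⟩ := exists_bOp_one_le hE
  obtain ⟨s, hs, hstail, -⟩ := exists_bOp_tail hE
  obtain ⟨R, hR0, hRs⟩ : ∃ R : ℝ, 0 < R ∧ ENNReal.ofReal (2 * ε₀) * s R ≤ 2⁻¹ := by
    have h1 : Tendsto (fun R => ENNReal.ofReal (2 * ε₀) * s R) atTop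
        (𝓝 (ENNReal.ofReal (2 * ε₀) * 0)) :=
      ENNReal.Tendsto.const_mul hs (Or.inr ENNReal.ofReal_ne_top)
    rw [mul_zero] at h1
    have h2 := h1.eventually (ge_mem_nhds (by simp : (0 : ℝ≥0∞) < 2⁻¹))
    obtain ⟨R, h3, h4⟩ := (h2.and (eventually_gt_atTop 0)).exists
    exact ⟨R, h4, h3⟩
  obtain ⟨c, hc, hlow⟩ := exists_le_renewFn hE (t₀ := ε₀ / 3) (by positivity) hR0
  set D := 8 * ε₀ * (2 * ε₀ + 8 * ε₀ ^ 2 * B.toReal) * (C * H.toReal) with hD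
  have hHn : 0 ≤ H.toReal := ENNReal.toReal_nonneg
  have hBn : 0 ≤ B.toReal := ENNReal.toReal_nonneg
  have hD0 : 0 ≤ D := by positivity
  refine ⟨min (1 / (8 * ε₀)) (c / (D + 1)), lt_min (by positivity) (by positivity),
    fun δ l hδ hδε hl hle hlA hfin => ?_⟩
  set L := l * Real.log (1 / l) with hL
  set A := min (1 / (8 * ε₀)) (c / (D + 1)) with hA
  have hA1 : A * (8 * ε₀) ≤ 1 := by
    rw [← le_div_iff₀ (by positivity)]; exact min_le_left _ _
  have hA0 : 0 < A := lt_min (by positivity) (by positivity)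
  have hA2 : A * D ≤ c := by
    have : A * (D + 1) ≤ c := by rw [← le_div_iff₀ (by positivity)]; exact min_le_right _ _
    linarith
  have hlog : 1 ≤ Real.log (1 / l) := by
    rw [one_div, Real.log_inv]
    have := Real.log_le_log hl hle
    rw [Real.log_exp] at this
    linarith
  have hlL : l ≤ L := by rw [hL]; nlinarith
  have hL0 : 0 ≤ L := hl.le.trans hlL
  have he1 : Real.exp (-1) ≤ 1 / 2 := by
    rw [Real.exp_neg, ← one_div]
    exact one_div_le_one_div_of_le two_pos (by have := Real.add_one_le_exp 1; linarith)
  set p := Real.exp (-l) with hp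
  have hp1 : p ≤ 1 := Real.exp_le_one_iff.2 (by linarith)
  have hpl : 1 - l ≤ p := by have := Real.add_one_le_exp (-l); linarith
  have hp3 : 1 / 3 ≤ p := by linarith
  set τ := p * (ε₀ + δ) with hτ
  have hτ0 : ε₀ / 3 ≤ τ := by rw [hτ]; nlinarith
  have hτ1 : τ ≤ 2 * ε₀ := by rw [hτ]; nlinarith
  have hτpos : 0 < τ := by linarith
  have hq3 : ENNReal.ofReal (1 / 3) ≤ ENNReal.ofReal p := ENNReal.ofReal_le_ofReal hp3
  have hq1 : ENNReal.ofReal p ≤ 1 := by simpa using hp1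
  have hgap : δ / 4 ≤ τ - (ε₀ + δ / 2) := by
    have h1 : (1 - l) * (ε₀ + δ) ≤ τ := by rw [hτ]; gcongr
    have h2 : l * (8 * ε₀) ≤ δ := by
      calc l * (8 * ε₀) ≤ A * δ * (8 * ε₀) := by gcongr; linarith
        _ = δ * (A * (8 * ε₀)) := by ring
        _ ≤ δ := mul_le_of_le_one_right hδ.le hA1
    nlinarith
  set h := renewFn (wt E) (ENNReal.ofReal p) (ENNReal.ofReal τ) with hh
  have h0 : ENNReal.ofReal τ * h 0 ≤ 1 := by
    refine mul_renewFn_zero_le_one hG (u := fun x => grandFn (wt E) (ENNReal.ofReal p)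
      (ENNReal.ofReal (ε₀ + δ)) (x, 0)) ?_ hfin fun x => ?_
    · have hpos : wt E 0 * wt E 0 ≠ 0 := by
        have : wt E 0 ≠ 0 := by simpa [wt] using hE.pos
        exact mul_ne_zero this this
      refine fun hz => hpos ?_
      have h1 := ENNReal.le_tsum (f := fun k => ENNReal.ofReal p ^ k *
        partFn (wt E) (ENNReal.ofReal (ε₀ + δ)) k (0, 0)) 0
      have h2 : (ENNReal.ofReal p) ^ 0 * partFn (wt E) (ENNReal.ofReal (ε₀ + δ)) 0 (0, 0) =
          wt E 0 * wt E 0 := by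
        simp [partFn, pinOp]
      rw [← nonpos_iff_eq_zero, ← h2]
      exact h1.trans hz.le
    · rw [hτ, ENNReal.ofReal_mul (by positivity)]
      exact grandFn_renewal_le hG x
  have hmass : ∫⁻ x, h x ≤ H := hH _ _ hq3 hq1 (ENNReal.ofReal_le_ofReal hτ0)
    (ENNReal.ofReal_le_ofReal hτ1) h0
  set η := C * L * H.toReal with hη
  have hη0 : 0 ≤ η := by positivity
  set ε := ε₀ + δ / 2 with hε
  have hε2 : ε ≤ 2 * ε₀ := by linarith
  have hκ : δ / (8 * ε₀) ≤ 1 - ε / τ := by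
    rw [one_sub_div hτpos.ne', div_le_div_iff₀ (by positivity) hτpos]
    nlinarith
  have hηH : ENNReal.ofReal η = ENNReal.ofReal (C * L) * H := by
    rw [hη, ENNReal.ofReal_mul (by positivity), ENNReal.ofReal_toReal hHt]
  have hsup := renewFn_supersolution hE (q := ENNReal.ofReal p) (τ := τ) (ε := ε) (κ := 1 - ε / τ)
    (η := η) (θ := 4 * ε₀ * η) (B := B.toReal) (R := R) (c := c) (S := s R) hτpos (by linarith) hη0
    (le_trans (by positivity) hκ) (by positivity) (by ring) h0
    (fun x => ((hdiff l hl hle h (measurable_renewFn hG) x).trans (by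
      rw [hηH]
      exact add_le_add le_rfl (mul_le_mul' le_rfl hmass))))
    (fun x => by rw [ENNReal.ofReal_toReal hBt]; exact hB x) hBn hR0.le
    (fun x hx => hstail R x hR0.le hx)
    ((mul_le_mul' (ENNReal.ofReal_le_ofReal hε2) le_rfl).trans hRs)
    (fun x hx => hlow _ _ hq3 (ENNReal.ofReal_le_ofReal hτ0) x hx)
    (by nlinarith)
    (by
      calc ε * η + ε * (4 * ε₀ * η * B.toReal)
          ≤ 2 * ε₀ * η + 2 * ε₀ * (4 * ε₀ * η * B.toReal) := by gcongr
        _ = (2 * ε₀ + 8 * ε₀ ^ 2 * B.toReal) * (C * H.toReal) * L := by rw [hη]; ring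
        _ ≤ (2 * ε₀ + 8 * ε₀ ^ 2 * B.toReal) * (C * H.toReal) * (A * δ) := by gcongr
        _ = δ / (8 * ε₀) * (A * D) := by rw [hD]; field_simp
        _ ≤ δ / (8 * ε₀) * c := by gcongr
        _ ≤ (1 - ε / τ) * c := by gcongr)
  have hvm : Measurable fun y => h y +
      ({0}ᶜ : Set ℝ).indicator (fun _ => ENNReal.ofReal (4 * ε₀ * η)) y :=
    (measurable_renewFn hG).add (measurable_const.indicator (measurableSet_singleton 0).compl)
  have hfinal := mul_partFn_le_of_supersolution hG (ε := ENNReal.ofReal ε) hvm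
    (fun x => le_add_right (by rw [hh, renewFn_eq hG]; exact le_self_add)) hsup
  have hτ' : ENNReal.ofReal τ ≠ 0 := by simpa using hτpos
  have hε' : ENNReal.ofReal ε ≠ 0 := by
    have : 0 < ε := by linarith
    simpa using this
  have hh0 : h 0 ≠ ∞ := fun ht => by
    rw [ht, ENNReal.mul_top hτ'] at h0
    simp at h0
  refine ⟨h 0 / ENNReal.ofReal ε, ENNReal.div_ne_top hh0 hε', fun k => ?_⟩
  rw [ENNReal.le_div_iff_mul_le (Or.inl hε') (Or.inl ENNReal.ofReal_ne_top), mul_comm]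
  simpa using hfinal k

lemma partFn_eq_ofReal_Zpin (hE : IsStepDensity E) (ε : ℝ) (k : ℕ) :
    partFn (wt E) (ENNReal.ofReal ε) k (0, 0) = ENNReal.ofReal (Zpin E ε (k + 1)) := by
  obtain ⟨M, -, hM⟩ := hE.exists_wt_le
  rw [Zpin_succ_eq hE, ENNReal.ofReal_toReal]
  exact partFn_ne_top hE.measurable_wt hE.lintegral_wt.le hM ENNReal.ofReal_ne_top _ _

lemma grandFn_ne_top_of_growth (hE : IsStepDensity E) {ε l l' : ℝ} (hl : l' < l)
    (h : ∀ᶠ N : ℕ in atTop, (N : ℝ)⁻¹ * Real.log (Zpin E ε N) < l') :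
    grandFn (wt E) (ENNReal.ofReal (Real.exp (-l))) (ENNReal.ofReal ε) (0, 0) ≠ ∞ := by
  have hZ0 : ∀ k, 0 ≤ Zpin E ε (k + 1) := fun k => by
    rw [Zpin_succ_eq hE]; exact ENNReal.toReal_nonneg
  have hZ : ∀ᶠ k : ℕ in atTop, Zpin E ε (k + 1) ≤ Real.exp l' * Real.exp l' ^ k := by
    filter_upwards [(tendsto_add_atTop_nat 1).eventually h] with k hk
    have hk1 : (0 : ℝ) < ((k + 1 : ℕ) : ℝ) := by positivity
    rw [inv_mul_lt_iff₀ hk1] at hk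
    calc Zpin E ε (k + 1) ≤ Real.exp (Real.log (Zpin E ε (k + 1))) := Real.le_exp_log _
      _ ≤ Real.exp (((k + 1 : ℕ) : ℝ) * l') := Real.exp_le_exp.2 hk.le
      _ = Real.exp l' * Real.exp l' ^ k := by rw [Real.exp_nat_mul, pow_succ']
  have hsum : Summable fun k => Real.exp (-l) ^ k * Zpin E ε (k + 1) := by
    have hg : Summable fun k : ℕ => Real.exp l' * Real.exp (l' - l) ^ k :=
      (summable_geometric_of_lt_one (Real.exp_pos _).le
        (Real.exp_lt_one_iff.2 (by linarith))).mul_left _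
    refine Summable.of_norm_bounded_eventually_nat hg ?_
    filter_upwards [hZ] with k hk
    rw [Real.norm_of_nonneg (mul_nonneg (by positivity) (hZ0 k))]
    calc Real.exp (-l) ^ k * Zpin E ε (k + 1)
        ≤ Real.exp (-l) ^ k * (Real.exp l' * Real.exp l' ^ k) := by gcongr
      _ = Real.exp l' * Real.exp (l' - l) ^ k := by
          rw [sub_eq_add_neg, Real.exp_add, mul_pow]; ring
  have h1 := hsum.tsum_ofReal_ne_top
  convert h1 using 1
  unfold grandFn
  refine tsum_congr fun k => ?_
  rw [partFn_eq_ofReal_Zpin hE, ENNReal.ofReal_mul (by positivity), ENNReal.ofReal_pow (by positivity)]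

lemma freeEnergy_nonpos_of_bounded (hE : IsStepDensity E) {ε : ℝ} {F : EReal}
    (hF : Tendsto (fun N : ℕ => (((N : ℝ)⁻¹ * Real.log (Zpin E ε N) : ℝ) : EReal)) atTop (𝓝 F))
    {K : ℝ≥0∞} (hK : K ≠ ∞) (h : ∀ k, partFn (wt E) (ENNReal.ofReal ε) k (0, 0) ≤ K) : F ≤ 0 := by
  have hZ : ∀ k, Zpin E ε (k + 1) ≤ max K.toReal 1 := fun k => by
    rw [Zpin_succ_eq hE]
    exact (ENNReal.toReal_mono hK (h k)).trans (le_max_left _ _)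
  have hlim : Tendsto (fun N : ℕ => (((N : ℝ)⁻¹ * Real.log (max K.toReal 1) : ℝ) : EReal)) atTop
      (𝓝 ((0 : ℝ) : EReal)) := by
    refine (continuous_coe_real_ereal.tendsto 0).comp ?_
    simpa using (tendsto_inv_atTop_nhds_zero_nat (𝕜 := ℝ)).mul_const (Real.log (max K.toReal 1))
  refine le_of_tendsto_of_tendsto hF hlim ?_
  filter_upwards [eventually_ge_atTop 1] with N hN
  obtain ⟨k, rfl⟩ := Nat.exists_eq_add_of_le' hN
  refine EReal.coe_le_coe_iff.2 (mul_le_mul_of_nonneg_left ?_ (by positivity))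
  have hnn : 0 ≤ Zpin E ε (k + 1) := by rw [Zpin_succ_eq hE]; exact ENNReal.toReal_nonneg
  rcases hnn.eq_or_lt with hz | hz
  · rw [← hz, Real.log_zero]; exact Real.log_nonneg (le_max_right _ _)
  · exact Real.log_le_log hz (hZ k)

/-- With `l = c δ / log (1/δ)` one has `l log (1/l) ≤ 3 c δ`. -/
lemma rate_bounds {c δ : ℝ} (hc : 0 < c) (hc1 : c ≤ 1) (hδ : 0 < δ) (hδc : δ ≤ c)
    (hδe : δ ≤ Real.exp (-1)) :
    0 < c * δ / Real.log (1 / δ) ∧ c * δ / Real.log (1 / δ) ≤ Real.exp (-1) ∧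
      c * δ / Real.log (1 / δ) * Real.log (1 / (c * δ / Real.log (1 / δ))) ≤ 3 * c * δ := by
  set y := Real.log (1 / δ) with hy
  have hy1 : 1 ≤ y := by
    rw [hy, one_div, Real.log_inv]
    have := Real.log_le_log hδ hδe
    rw [Real.log_exp] at this
    linarith
  have hy0 : 0 < y := by linarith
  have hpos : 0 < c * δ / y := by positivity
  refine ⟨hpos, ?_, ?_⟩
  · rw [div_le_iff₀ hy0]
    have : 0 < Real.exp (-1) := Real.exp_pos _
    nlinarith
  · have h1 : Real.log (1 / (c * δ / y)) ≤ 3 * y := by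
      have e : 1 / (c * δ / y) = (1 / c) * ((1 / δ) * y) := by field_simp
      rw [e, Real.log_mul (by positivity) (by positivity), Real.log_mul (by positivity) hy0.ne']
      have h2 : Real.log (1 / c) ≤ y := Real.log_le_log (by positivity)
        (one_div_le_one_div_of_le hδ hδc)
      have h3 : Real.log y ≤ y := (Real.log_le_sub_one_of_pos hy0).trans (by linarith)
      linarith
    calc c * δ / y * Real.log (1 / (c * δ / y)) ≤ c * δ / y * (3 * y) := by gcongr
      _ = 3 * c * δ := by field_simp

end

end LaplacianPinning

/-- **Theorem 1.4**, second part: the pinning transition is exactly of second order: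
`F^p(ε_c^p + δ) ≥ c δ / log(1/δ)` for small `δ > 0`. -/
theorem pinning_free_energy_lower_bound_at_criticality
    (E : ℝ → ℝ) (σ : ℝ)
    (hE_nonneg : ∀ x, 0 ≤ E x) (hE_cont : Continuous E)
    (hE_bdd : ∃ M, ∀ x, E x ≤ M) (hE_pos : 0 < E 0)
    (hE_int : Integrable E) (hE_mass : ∫ x, E x = 1)
    (hE_mom1 : Integrable fun x => x * E x) (hE_mean : ∫ x, x * E x = 0)
    (hE_mom2 : Integrable fun x => x ^ 2 * E x) (hE_var : ∫ x, x ^ 2 * E x = σ ^ 2)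
    (hσ : 0 < σ)
    (Fp : ℝ → EReal)
    (hFp_nonneg : ∀ ε : ℝ, 0 ≤ ε → 0 ≤ Fp ε)
    (hFp : ∀ ε : ℝ, 0 ≤ ε → Tendsto
      (fun N : ℕ => (((N : ℝ)⁻¹ * Real.log (Zpin E ε N) : ℝ) : EReal)) atTop (𝓝 (Fp ε)))
    (εcp : ℝ) (hεcp : IsLUB {ε : ℝ | 0 < ε ∧ Fp ε = 0} εcp) (hεcp_pos : 0 < εcp) :
    ∃ c : ℝ, 0 < c ∧ ∃ δ₀ : ℝ, 0 < δ₀ ∧ δ₀ < 1 ∧ ∀ δ : ℝ, 0 < δ → δ < δ₀ →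
      ((c * δ / Real.log (1 / δ) : ℝ) : EReal) ≤ Fp (εcp + δ) := by
  have hE : LaplacianPinning.IsStepDensity E :=
    ⟨hE_nonneg, hE_cont, hE_bdd, hE_pos, hE_int, hE_mass⟩
  obtain ⟨A, hA, hbounded⟩ := LaplacianPinning.exists_partFn_bounded hE hεcp_pos
  set c := min (A / 3) 1 with hc
  have hc0 : 0 < c := lt_min (by positivity) one_pos
  refine ⟨c, hc0, min c (min εcp (Real.exp (-1))),
    lt_min hc0 (lt_min hεcp_pos (Real.exp_pos _)),
    ((min_le_right _ _).trans (min_le_right _ _)).trans_lt (Real.exp_lt_one_iff.2 (by norm_num)),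
    fun δ hδ hδ₀ => ?_⟩
  obtain ⟨hδc, hδ₁⟩ := lt_min_iff.1 hδ₀
  obtain ⟨hδε, hδe⟩ := lt_min_iff.1 hδ₁
  obtain ⟨hl, hle, hlA⟩ :=
    LaplacianPinning.rate_bounds hc0 (min_le_right _ _) hδ hδc.le hδe.le
  by_contra! hlt
  obtain ⟨l', hl'1, hl'2⟩ := EReal.lt_iff_exists_real_btwn.1 hlt
  have hgrowth : ∀ᶠ N : ℕ in atTop, (N : ℝ)⁻¹ * Real.log (Zpin E (εcp + δ) N) < l' :=
    ((hFp (εcp + δ) (by linarith)).eventually (gt_mem_nhds hl'1)).mono fun N hN =>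
      EReal.coe_lt_coe_iff.1 hN
  obtain ⟨K, hK, hKb⟩ := hbounded δ _ hδ hδε.le hl hle
    (hlA.trans (by
      have : c ≤ A / 3 := min_le_left _ _
      nlinarith))
    (LaplacianPinning.grandFn_ne_top_of_growth hE (EReal.coe_lt_coe_iff.1 hl'2) hgrowth)
  have hzero : Fp (εcp + δ / 2) = 0 :=
    le_antisymm (LaplacianPinning.freeEnergy_nonpos_of_bounded hE (hFp _ (by linarith)) hK hKb)
      (hFp_nonneg _ (by linarith))
  have := hεcp.1 (show εcp + δ / 2 ∈ {ε : ℝ | 0 < ε ∧ Fp ε = 0} from ⟨by linarith, hzero⟩)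
  linarith
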